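/- arXiv:1101.2521 — 2 statements merged into one kernel-verified Lean document; each statement's English description precedes it below -/
import Mathlib

section
/- Let f : ℝ² → ℝ² be a C¹ diffeomorphism isotopic to the identity via an isotopy I = (f_t), and suppose there exist points x ≠ y in ℝ² and an integer n > 0 such that Linking_n(I, x, y) = ε ≠ 0. Then there exist a point z ∈ ℝ² and a unit vector ξ ∈ T_zℝ² such that |Torsion_n(I, z, ξ)| ≥ |ε|/3 − 1/n. -/
open Real Filter

/-- The point of the circle with argument `θ` (measured in full turns), as a vector in the
Euclidean plane. -/
noncomputable def e2 (θ : ℝ) : EuclideanSpace ℝ (Fin 2) :=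
  (WithLp.equiv 2 (Fin 2 → ℝ)).symm ![Real.cos (2*π*θ), Real.sin (2*π*θ)]

/-- A nonvanishing continuous function on a real vector space has a continuous logarithm with
prescribed value at one point. -/
theorem exists_continuous_log {E : Type*} [NormedAddCommGroup E] [NormedSpace ℝ E] {g : E → ℂ}
    (hg : Continuous g) (hg0 : ∀ p, g p ≠ 0) (p₀ : E) (l₀ : ℂ) (h₀ : Complex.exp l₀ = g p₀) :
    ∃ l : E → ℂ, Continuous l ∧ l p₀ = l₀ ∧ ∀ p, Complex.exp (l p) = g p := by
  obtain ⟨l, ⟨hl₀, hl⟩, -⟩ :=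
    Complex.isCoveringMapOn_exp.existsUnique_continuousMap_lifts ⟨g, hg⟩ h₀ hg0
  exact ⟨l, l.continuous, hl₀, congrFun hl⟩

theorem eq_of_exp_eq_exp {X : Type*} [TopologicalSpace X] [PreconnectedSpace X] {f g : X → ℂ}
    (hf : Continuous f) (hg : Continuous g) (h : ∀ p, Complex.exp (f p) = Complex.exp (g p))
    {p₀ : X} (h₀ : f p₀ = g p₀) : f = g :=
  Complex.isCoveringMap_exp.eq_of_comp_eq hf hg (funext fun p ↦ Subtype.ext (h p)) p₀ h₀

/-- A continuous logarithm of a differentiable function is differentiable. -/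
theorem hasDerivAt_of_hasDerivAt_exp {L m : ℝ → ℂ} (hL : Continuous L) (hm : Continuous m)
    (h : ∀ p, HasDerivAt (fun q ↦ Complex.exp (L q)) (m p * Complex.exp (L p)) p) (p : ℝ) :
    HasDerivAt L (m p) p := by
  set G : ℝ → ℂ := fun q ↦ L p + ∫ t in p..q, m t with hG
  have hGd (q : ℝ) : HasDerivAt G (m q) q :=
    (intervalIntegral.integral_hasDerivAt_right (hm.intervalIntegrable _ _)
      (hm.stronglyMeasurableAtFilter _ _) hm.continuousAt).const_add _
  have hGp : G p = L p := by simp [hG]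
  have hd (q : ℝ) : HasDerivAt (fun q ↦ Complex.exp (-G q) * Complex.exp (L q)) 0 q := by
    convert! (hGd q).neg.cexp.mul (h q) using 1
    ring
  have hconst (q : ℝ) : Complex.exp (-G q) * Complex.exp (L q) = 1 := by
    have := is_const_of_deriv_eq_zero (fun q ↦ (hd q).differentiableAt) (fun q ↦ (hd q).deriv) q p
    simpa [hGp, ← Complex.exp_add] using this
  have hGL : G = L := by
    refine eq_of_exp_eq_exp (continuous_iff_continuousAt.2 fun q ↦ (hGd q).continuousAt) hL
      (fun q ↦ ?_) hGp
    have := hconst q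
    rw [Complex.exp_neg, inv_mul_eq_one₀ (Complex.exp_ne_zero _)] at this
    exact this
  exact hGL ▸ hGd p

theorem smul_integral_segment_eq_sub {E : Type*} [NormedAddCommGroup E] [NormedSpace ℝ E]
    [CompleteSpace E] {f f' : ℝ → E} (hf' : Continuous f') (hf : ∀ s, HasDerivAt f (f' s) s)
    (s h : ℝ) : h • ∫ r in (0 : ℝ)..1, f' (s + r * h) = f (s + h) - f s := by
  have := intervalIntegral.integral_unitInterval_deriv_eq_sub (f := f) (f' := f') (z₀ := s) (z₁ := h)
    (by fun_prop) (fun t _ ↦ hf _)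
  simpa using this

/-- Let `c` be an injective differentiable curve, `a` a continuous logarithm of the chord slope
`s ↦ (c s - c 0) / s` and `b` one of the derivative of `c`, agreeing at `0`. At a first maximum of
the argument of the chord, the tangent has turned at least as much as the chord. -/
theorem im_le_im_of_first_max {c B a b : ℝ → ℂ} (hc : ∀ s, HasDerivAt c (B s) s)
    (hinj : Function.Injective c) (ha : Continuous a) (hb : Continuous b)
    (hexpa : ∀ s : ℝ, s * Complex.exp (a s) = c s - c 0) (hexpb : ∀ s, Complex.exp (b s) = B s)
    (hab : a 0 = b 0) {s₁ : ℝ} (hs₁ : 0 < s₁)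
    (hmax : ∀ s, 0 ≤ s → s < s₁ → (a s).im < (a s₁).im) : (a s₁).im ≤ (b s₁).im := by
  set L : ℝ → ℂ := fun p ↦ p + a (Real.exp p) with hLdef
  set μ : ℝ → ℂ := fun p ↦ b (Real.exp p) - a (Real.exp p) with hμdef
  have hLc : Continuous L := by fun_prop
  have hμc : Continuous μ := by fun_prop
  have hexpL (p : ℝ) : Complex.exp (L p) = c (Real.exp p) - c 0 := by
    rw [← hexpa, hLdef, Complex.exp_add, Complex.ofReal_exp]
  have hLd (p : ℝ) : HasDerivAt L (Complex.exp (μ p)) p := by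
    refine hasDerivAt_of_hasDerivAt_exp (m := fun p ↦ Complex.exp (μ p)) hLc (by fun_prop)
      (fun p ↦ ?_) p
    simp_rw [hexpL]
    convert! ((hc (Real.exp p)).scomp p (Real.hasDerivAt_exp p)).sub_const (c 0) using 1
    rw [← hexpL, ← Complex.exp_add, ← hexpb, hLdef, hμdef]
    simp only [Complex.real_smul, Complex.ofReal_exp]
    rw [← Complex.exp_add]
    congr 1
    ring
  have hLinj : Function.Injective L := fun p q h ↦ by
    have := hexpL p
    rw [h, hexpL q, sub_left_inj] at this
    exact (Real.exp_injective (hinj this)).symm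
  -- the chord slopes of `L`, extended by the derivative
  set Q : ℝ × ℝ → ℂ := fun z ↦ ∫ r in (0 : ℝ)..1, Complex.exp (μ (z.1 + r * (z.2 - z.1)))
  have hQc : Continuous Q :=
    intervalIntegral.continuous_parametric_intervalIntegral_of_continuous' (by fun_prop) _ _
  have hQ (p q : ℝ) : ((q - p : ℝ) : ℂ) * Q (p, q) = L q - L p := by
    simpa using smul_integral_segment_eq_sub (by fun_prop) hLd p (q - p)
  have hQdiag (p : ℝ) : Q (p, p) = Complex.exp (μ p) := by simp [Q]
  have hQ0 (z : ℝ × ℝ) : Q z ≠ 0 := by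
    obtain ⟨p, q⟩ := z
    rcases eq_or_ne p q with rfl | hpq
    · rw [hQdiag]
      exact Complex.exp_ne_zero _
    · intro h
      have := hQ p q
      rw [h, mul_zero, eq_comm, sub_eq_zero] at this
      exact hpq (hLinj this).symm
  obtain ⟨l, hlc, hl0, hl⟩ := exists_continuous_log hQc hQ0 (0, 0) (μ 0) (hQdiag 0).symm
  have hldiag : (fun p ↦ l (p, p)) = μ :=
    eq_of_exp_eq_exp (by fun_prop) hμc (fun p ↦ by rw [hl, hQdiag]) hl0
  have hQre (z : ℝ × ℝ) : (Q z).re = Real.exp (l z).re * Real.cos (l z).im := by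
    rw [← hl, Complex.exp_re]
  have hQim (z : ℝ × ℝ) : (Q z).im = Real.exp (l z).re * Real.sin (l z).im := by
    rw [← hl, Complex.exp_im]
  set P := Real.log s₁ with hP
  have hexpP : Real.exp P = s₁ := Real.exp_log hs₁
  have hμ_bot : Tendsto μ atBot (nhds 0) := by
    have h0 : Tendsto (fun s ↦ b s - a s) (nhds 0) (nhds 0) := by
      have : Continuous fun s ↦ b s - a s := by fun_prop
      simpa [hab] using this.tendsto 0
    exact h0.comp Real.tendsto_exp_atBot
  have hLre_bot : Tendsto (fun p ↦ (L p).re) atBot atBot := by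
    have h0 : Tendsto (fun p ↦ (a (Real.exp p)).re) atBot (nhds (a 0).re) :=
      ((Complex.continuous_re.comp ha).tendsto 0).comp Real.tendsto_exp_atBot
    simpa [hLdef] using tendsto_id.atBot_add h0
  -- chords ending at `P` point upwards
  have hsin (p : ℝ) (hp : p < P) : 0 < Real.sin (l (p, P)).im := by
    have h1 := congrArg Complex.im (hQ p P)
    rw [Complex.im_ofReal_mul, hQim, Complex.sub_im] at h1
    have h2 : (L p).im < (L P).im := by
      have := hmax (Real.exp p) (Real.exp_pos p).le (by rw [← hexpP]; exact Real.exp_lt_exp.2 hp)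
      simpa [hLdef, hexpP] using this
    have h3 : 0 < (P - p) * (Real.exp (l (p, P)).re * Real.sin (l (p, P)).im) := by linarith
    exact pos_of_mul_pos_right (pos_of_mul_pos_right h3 (by linarith)) (Real.exp_pos _).le
  obtain ⟨q, hqP, hq⟩ : ∃ q < P, ∀ p ≤ q, -(π / 2) < (μ p).im := by
    have h1 : ∀ᶠ p in atBot, -(π / 2) < (μ p).im := by
      have : Tendsto (fun p ↦ (μ p).im) atBot (nhds (0 : ℂ).im) :=
        (Complex.continuous_im.tendsto _).comp hμ_bot
      exact this.eventually_const_lt (by simp [Real.pi_pos])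
    obtain ⟨q, hq⟩ := eventually_atBot.1 h1
    exact ⟨min q (P - 1), by linarith [min_le_right q (P - 1)],
      fun p hp ↦ hq p (hp.trans (min_le_left _ _))⟩
  -- a starting point from which all chords point to the right
  obtain ⟨p₀, hp₀q, hp₀⟩ : ∃ p₀ ≤ q, ∀ p, p₀ < p → p ≤ P → (L p₀).re < (L p).re := by
    have hLre : Continuous fun p ↦ (L p).re := by fun_prop
    obtain ⟨t, -, ht⟩ := isCompact_Icc.exists_isMinOn (Set.nonempty_Icc.2 hqP.le)
      hLre.continuousOn
    obtain ⟨r, hr, hrq⟩ :=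
      ((hLre_bot.eventually_lt_atBot (L t).re).and (eventually_le_atBot q)).exists
    obtain ⟨p₀, ⟨⟨hp1, hp2⟩, hp3⟩, hp4⟩ :=
      (isCompact_Icc.inter_right (isClosed_le hLre continuous_const) :
        IsCompact (Set.Icc r P ∩ {p | (L p).re ≤ (L r).re})).exists_isGreatest
      ⟨r, ⟨le_rfl, hrq.trans hqP.le⟩, le_refl (L r).re⟩
    refine ⟨p₀, ?_, fun p hp hpP ↦ ?_⟩
    · by_contra! h
      have h1 := ht ⟨h.le, hp2⟩
      simp only [Set.mem_ofPred_eq] at h1 hp3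
      linarith
    · by_contra! h
      have := hp4 ⟨⟨hp1.trans hp.le, hpP⟩, h.trans hp3⟩
      linarith
  have hcos (p : ℝ) (hp : p₀ < p) (hpP : p ≤ P) : 0 < Real.cos (l (p₀, p)).im := by
    have h1 := congrArg Complex.re (hQ p₀ p)
    rw [Complex.re_ofReal_mul, hQre, Complex.sub_re] at h1
    have h3 : 0 < (p - p₀) * (Real.exp (l (p₀, p)).re * Real.cos (l (p₀, p)).im) := by
      linarith [hp₀ p hp hpP]
    exact pos_of_mul_pos_right (pos_of_mul_pos_right h3 (by linarith)) (Real.exp_pos _).le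
  have hp₀P : p₀ < P := hp₀q.trans_lt hqP
  have hstart : 0 < (l (p₀, P)).im := by
    by_contra! hneg
    have h1 : (l (p₀, P)).im ≤ -(π / 2) := by
      by_contra! h
      exact absurd (hsin p₀ hp₀P)
        (Real.sin_nonpos_of_nonpos_of_neg_pi_le hneg (by linarith [Real.pi_pos])).not_gt
    have h2 : -(π / 2) < (l (p₀, p₀)).im := by
      rw [congrFun hldiag p₀]
      exact hq p₀ hp₀q
    have hcont : Continuous fun p ↦ (l (p₀, p)).im := by fun_prop
    obtain ⟨p, ⟨hp1, hp2⟩, hp3⟩ := intermediate_value_Icc' hp₀P.le hcont.continuousOn ⟨h1, h2.le⟩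
    simp only at hp3
    have hne : p₀ ≠ p := by
      rintro rfl
      linarith
    have := hcos p (lt_of_le_of_ne hp1 hne) hp2
    rw [hp3, Real.cos_neg, Real.cos_pi_div_two] at this
    exact lt_irrefl _ this
  have hend : 0 ≤ (l (P, P)).im := by
    by_contra! hneg
    have hcont : Continuous fun p ↦ (l (p, P)).im := by fun_prop
    obtain ⟨p, ⟨hp1, hp2⟩, hp3⟩ :=
      intermediate_value_Ioo' hp₀P.le hcont.continuousOn ⟨hneg, hstart⟩
    have := hsin p hp2
    simp only at hp3
    rw [hp3, Real.sin_zero] at this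
    exact lt_irrefl _ this
  have := congrFun hldiag P
  simp only [hμdef, hexpP] at this
  rw [this, Complex.sub_im] at hend
  linarith

/-- The tangent of an injective curve turns, at some parameter, at least as much as the chord
from `c 0` to `c 1`. -/
theorem exists_im_ge {c B a b : ℝ → ℂ} (hc : ∀ s, HasDerivAt c (B s) s)
    (hinj : Function.Injective c) (ha : Continuous a) (hb : Continuous b)
    (hexpa : ∀ s : ℝ, s * Complex.exp (a s) = c s - c 0) (hexpb : ∀ s, Complex.exp (b s) = B s)
    (hab : a 0 = b 0) : ∃ s, (a 1).im ≤ (b s).im := by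
  have hcl : IsClosed {s | (a 1).im ≤ (a s).im} := isClosed_le (by fun_prop) (by fun_prop)
  obtain ⟨s₁, ⟨⟨h0, -⟩, h1⟩, hleast⟩ :=
    (isCompact_Icc.inter_right hcl : IsCompact (Set.Icc (0 : ℝ) 1 ∩ _)).exists_isLeast
      ⟨1, ⟨zero_le_one, le_rfl⟩, le_refl (a 1).im⟩
  simp only [Set.mem_ofPred_eq] at h1
  refine ⟨s₁, h1.trans ?_⟩
  rcases h0.eq_or_lt with rfl | hpos
  · rw [hab]
  · refine im_le_im_of_first_max hc hinj ha hb hexpa hexpb hab hpos fun s hs hlt ↦ ?_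
    by_contra! h
    have hs1 : s₁ ≤ 1 := hleast ⟨⟨zero_le_one, le_rfl⟩, le_refl (a 1).im⟩
    linarith [hleast ⟨⟨hs, hlt.le.trans hs1⟩, h1.trans h⟩]

theorem exists_im_le {c B a b : ℝ → ℂ} (hc : ∀ s, HasDerivAt c (B s) s)
    (hinj : Function.Injective c) (ha : Continuous a) (hb : Continuous b)
    (hexpa : ∀ s : ℝ, s * Complex.exp (a s) = c s - c 0) (hexpb : ∀ s, Complex.exp (b s) = B s)
    (hab : a 0 = b 0) : ∃ s, (b s).im ≤ (a 1).im := by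
  obtain ⟨s, hs⟩ := exists_im_ge (c := fun s ↦ star (c s)) (B := fun s ↦ star (B s))
    (a := fun s ↦ star (a s)) (b := fun s ↦ star (b s)) (fun s ↦ (hc s).star)
    (star_injective.comp hinj) (by fun_prop) (by fun_prop)
    (fun s ↦ by simpa [← Complex.exp_conj] using congrArg star (hexpa s))
    (fun s ↦ by simp [← hexpb, ← Complex.exp_conj]) (congrArg star hab)
  exact ⟨s, by simpa using hs⟩

/-- A continuous logarithm and a continuous argument of the same function have the same
variation. -/
theorem im_sub_im_eq_of_exp_eq {f : ℝ → ℂ} {ρ θ : ℝ → ℝ} (hf : Continuous f)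
    (hθ : Continuous θ) (hρ : ∀ t, 0 ≤ ρ t)
    (h : ∀ t, Complex.exp (f t) = ρ t * Complex.exp (θ t * Complex.I)) (s t : ℝ) :
    (f t).im - (f s).im = θ t - θ s := by
  have hρf (t : ℝ) : ρ t = Real.exp (f t).re := by
    have := congrArg norm (h t)
    rw [norm_mul, Complex.norm_exp_ofReal_mul_I, Complex.norm_exp, mul_one, Complex.norm_real,
      Real.norm_of_nonneg (hρ t)] at this
    exact this.symm
  set g : ℝ → ℂ := fun t ↦ (f t).re + θ t * Complex.I with hg
  have hgf (t : ℝ) : Complex.exp (g t) = Complex.exp (f t) := by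
    rw [h, hρf, hg, Complex.exp_add, Complex.ofReal_exp]
  have hfg : f = fun t ↦ g t + (f s - g s) := by
    refine eq_of_exp_eq_exp hf (by fun_prop) (fun t ↦ ?_) (p₀ := s) (by ring)
    rw [Complex.exp_add, Complex.exp_sub, hgf, hgf, div_self (Complex.exp_ne_zero _), mul_one]
  have := congrArg Complex.im (congrFun hfg t)
  simp [hg] at this
  linarith

/-- The standard isometry from the Euclidean plane to `ℂ`. -/
noncomputable def planeToComplex : EuclideanSpace ℝ (Fin 2) ≃ₗᵢ[ℝ] ℂ :=
  Complex.orthonormalBasisOneI.repr.symm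

theorem planeToComplex_e2 (θ : ℝ) :
    planeToComplex (e2 θ) = Complex.exp ((2 * π * θ : ℝ) * Complex.I) := by
  rw [planeToComplex, Complex.orthonormalBasisOneI_repr_symm_apply, Complex.exp_mul_I]
  simp [e2]

theorem eq_norm_smul_e2 {X : EuclideanSpace ℝ (Fin 2)} {ρ θ : ℝ} (hρ : 0 ≤ ρ)
    (h : planeToComplex X = ρ * Complex.exp ((2 * π * θ : ℝ) * Complex.I)) :
    X = ‖X‖ • e2 θ := by
  apply planeToComplex.injective
  have hX : ‖X‖ = ρ := by
    rw [← planeToComplex.norm_map, h, norm_mul, Complex.norm_exp_ofReal_mul_I, mul_one,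
      Complex.norm_real, Real.norm_of_nonneg hρ]
  rw [map_smul, planeToComplex_e2, hX, h, Complex.real_smul]

/-- Lemma 3.2 of the paper. Let `(F t)_{t ∈ ℝ}` be a `C¹` isotopy of diffeomorphisms of the
plane starting at the identity (with `F (t+1) = F t ∘ F 1`, so that `F n = fⁿ` for the
diffeomorphism `f = F 1`), with derivative in space `D t z` (invertible, jointly continuous).
If two points `x ≠ y` have `n`-step linking number `ε ≠ 0` — i.e. `ε = (v(n) - v(0))/n` for a
continuous argument lift `v` of the direction of `F t x - F t y` — then there is a point `z`
and a unit tangent vector `ξ` whose `n`-step torsion `(w(n) - w(0))/n` (where `w` is a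
continuous argument lift of the direction of `D t z ξ`) satisfies
`|Torsion_n| ≥ |ε|/3 - 1/n`. -/
theorem torsion_ge_of_linking
    (F : ℝ → EuclideanSpace ℝ (Fin 2) → EuclideanSpace ℝ (Fin 2))
    (hF0 : F 0 = id)
    (hFext : ∀ t : ℝ, F (t + 1) = F t ∘ F 1)
    (hFcont : Continuous fun p : ℝ × EuclideanSpace ℝ (Fin 2) => F p.1 p.2)
    (hFbij : ∀ t : ℝ, Function.Bijective (F t))
    (D : ℝ → EuclideanSpace ℝ (Fin 2) →
      (EuclideanSpace ℝ (Fin 2) →L[ℝ] EuclideanSpace ℝ (Fin 2)))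
    (hD : ∀ (t : ℝ) (z : EuclideanSpace ℝ (Fin 2)), HasFDerivAt (F t) (D t z) z)
    (hDcont : Continuous fun p : ℝ × EuclideanSpace ℝ (Fin 2) => D p.1 p.2)
    (hDbij : ∀ (t : ℝ) (z : EuclideanSpace ℝ (Fin 2)), Function.Bijective (D t z))
    (x y : EuclideanSpace ℝ (Fin 2)) (hxy : x ≠ y) (n : ℕ) (hn : 1 ≤ n)
    (v : ℝ → ℝ) (hvc : Continuous v)
    (hv : ∀ t : ℝ, F t x - F t y = ‖F t x - F t y‖ • e2 (v t))
    (ε : ℝ) (hε : ε = (v n - v 0) / n) (hε0 : ε ≠ 0) :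
    ∃ (z ξ : EuclideanSpace ℝ (Fin 2)), ‖ξ‖ = 1 ∧
      ∃ w : ℝ → ℝ, Continuous w ∧
        (∀ t : ℝ, D t z ξ = ‖D t z ξ‖ • e2 (w t)) ∧
        |ε| / 3 - 1 / n ≤ |(w n - w 0) / n| := by
  set u := y - x with hu
  have hu0 : u ≠ 0 := sub_ne_zero.2 hxy.symm
  set c : ℝ → ℝ → ℂ := fun t s ↦ planeToComplex (F t (x + s • u)) with hcdef
  set B : ℝ × ℝ → ℂ := fun p ↦ planeToComplex (D p.2 (x + p.1 • u) u) with hBdef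
  set A : ℝ × ℝ → ℂ := fun p ↦ ∫ r in (0 : ℝ)..1, B (0 + r * p.1, p.2) with hAdef
  have hBc : Continuous B := by
    have : Continuous fun p : ℝ × ℝ ↦ D p.2 (x + p.1 • u) :=
      hDcont.comp (by fun_prop : Continuous fun p : ℝ × ℝ ↦ (p.2, x + p.1 • u))
    fun_prop
  have hAc : Continuous A :=
    intervalIntegral.continuous_parametric_intervalIntegral_of_continuous' (by fun_prop) _ _
  have hc (t s : ℝ) : HasDerivAt (c t) (B (s, t)) s := by
    have h1 : HasDerivAt (fun s : ℝ ↦ x + s • u) u s := by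
      simpa using ((hasDerivAt_id s).smul_const u).const_add x
    exact (planeToComplex.toContinuousLinearEquiv.toContinuousLinearMap.hasFDerivAt.comp_hasDerivAt
      s ((hD t (x + s • u)).comp_hasDerivAt s h1))
  have hcinj (t : ℝ) : Function.Injective (c t) := fun s s' h ↦ by
    have h1 := add_left_cancel ((hFbij t).1 (planeToComplex.injective h))
    exact smul_left_injective ℝ hu0 h1
  have hA (s t : ℝ) : s * A (s, t) = c t s - c t 0 := by
    simpa [hAdef] using smul_integral_segment_eq_sub (f := c t) (f' := fun s ↦ B (s, t)) (by fun_prop)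
      (hc t) 0 s
  have hB0 (p : ℝ × ℝ) : B p ≠ 0 := by
    simp only [hBdef, ne_eq, EmbeddingLike.map_eq_zero_iff]
    exact fun h ↦ hu0 ((hDbij _ _).1 (h.trans (map_zero _).symm))
  have hA_zero (t : ℝ) : A (0, t) = B (0, t) := by simp [hAdef]
  have hA0 (p : ℝ × ℝ) : A p ≠ 0 := by
    obtain ⟨s, t⟩ := p
    rcases eq_or_ne s 0 with rfl | hs
    · rw [hA_zero]
      exact hB0 _
    · intro h
      have := hA s t
      rw [h, mul_zero, eq_comm, sub_eq_zero] at this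
      exact hs (hcinj t this)
  have hD0 (z : EuclideanSpace ℝ (Fin 2)) : D 0 z = ContinuousLinearMap.id ℝ _ :=
    (hF0 ▸ hD 0 z).unique (hasFDerivAt_id z)
  have hBt0 (s : ℝ) : B (s, 0) = planeToComplex u := by simp [hBdef, hD0]
  have hAt0 (s : ℝ) : A (s, 0) = planeToComplex u := by simp [hAdef, hBt0]
  have hl₀ : Complex.exp (Complex.log (planeToComplex u)) = planeToComplex u :=
    Complex.exp_log (by simpa using hu0)
  set l₀ := Complex.log (planeToComplex u)
  obtain ⟨a, hac, ha0, ha⟩ :=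
    exists_continuous_log hAc hA0 (0, 0) l₀ (hl₀.trans (hAt0 0).symm)
  obtain ⟨b, hbc, hb0, hb⟩ :=
    exists_continuous_log hBc hB0 (0, 0) l₀ (hl₀.trans (hBt0 0).symm)
  have hat0 : (fun s : ℝ ↦ a (s, 0)) = fun _ ↦ l₀ :=
    eq_of_exp_eq_exp (by fun_prop) (by fun_prop) (fun s ↦ by rw [ha, hAt0, hl₀]) ha0
  have hbt0 : (fun s : ℝ ↦ b (s, 0)) = fun _ ↦ l₀ :=
    eq_of_exp_eq_exp (by fun_prop) (by fun_prop) (fun s ↦ by rw [hb, hBt0, hl₀]) hb0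
  have hab : (fun t : ℝ ↦ a (0, t)) = fun t ↦ b (0, t) :=
    eq_of_exp_eq_exp (by fun_prop) (by fun_prop) (fun t ↦ by rw [ha, hb, hA_zero])
      (ha0.trans hb0.symm)
  have hlink : (a (1, (n : ℝ))).im - l₀.im = 2 * π * (v n - v 0) := by
    have h1 (t : ℝ) : Complex.exp (a (1, t)) =
        (‖F t x - F t y‖ : ℝ) * Complex.exp ((2 * π * v t + π : ℝ) * Complex.I) := by
      have h2 := congrArg planeToComplex (hv t)
      rw [map_smul, planeToComplex_e2, Complex.real_smul, map_sub] at h2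
      rw [Complex.ofReal_add, add_mul, Complex.exp_add, Complex.exp_pi_mul_I, ← mul_assoc, ← h2, ha]
      have h3 := hA 1 t
      simp only [Complex.ofReal_one, one_mul] at h3
      simp [h3, hcdef, hu]
    have h2 := im_sub_im_eq_of_exp_eq (f := fun t ↦ a (1, t)) (by fun_prop)
      (θ := fun t ↦ 2 * π * v t + π) (by fun_prop) (fun t ↦ norm_nonneg _) h1 0 n
    rw [congrFun hat0 1] at h2
    linarith
  have key : ∃ s, |v n - v 0| ≤ |((b (s, (n : ℝ))).im - l₀.im) / (2 * π)| := by
    have hexpa (s : ℝ) : s * Complex.exp (a (s, (n : ℝ))) = c n s - c n 0 := by rw [ha, hA]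
    have hπ : 0 < 2 * π := by positivity
    have hv' : v n - v 0 = ((a (1, (n : ℝ))).im - l₀.im) / (2 * π) := by
      rw [hlink]
      field_simp
    rcases le_total 0 (v n - v 0) with hN | hN
    · obtain ⟨s, hs⟩ := exists_im_ge (a := fun s ↦ a (s, (n : ℝ))) (b := fun s ↦ b (s, (n : ℝ)))
        (hc n) (hcinj n) (by fun_prop) (by fun_prop) hexpa (fun s ↦ hb _) (congrFun hab n)
      refine ⟨s, abs_le_abs_of_nonneg hN ?_⟩
      rw [hv']
      gcongr
    · obtain ⟨s, hs⟩ := exists_im_le (a := fun s ↦ a (s, (n : ℝ))) (b := fun s ↦ b (s, (n : ℝ)))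
        (hc n) (hcinj n) (by fun_prop) (by fun_prop) hexpa (fun s ↦ hb _) (congrFun hab n)
      refine ⟨s, abs_le_abs_of_nonpos hN ?_⟩
      rw [hv']
      gcongr
  obtain ⟨s, hs⟩ := key
  refine ⟨x + s • u, ‖u‖⁻¹ • u, norm_smul_inv_norm hu0, fun t ↦ (b (s, t)).im / (2 * π),
    by fun_prop, fun t ↦ ?_, ?_⟩
  · refine eq_norm_smul_e2 (ρ := ‖u‖⁻¹ * Real.exp (b (s, t)).re) (by positivity) ?_
    have h1 : planeToComplex (D t (x + s • u) u) = Complex.exp (b (s, t)) := (hb (s, t)).symm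
    rw [map_smul, map_smul, h1, mul_div_cancel₀ _ (by positivity), Complex.real_smul,
      Complex.ofReal_mul, mul_assoc, Complex.ofReal_exp, ← Complex.exp_add, Complex.re_add_im]
  · have h1 : |ε| ≤ |((b (s, (n : ℝ))).im / (2 * π) - (b (s, 0)).im / (2 * π)) / n| := by
      rw [hε, congrFun hbt0 s, ← sub_div, abs_div, abs_div _ (n : ℝ)]
      gcongr
    have h2 : (0 : ℝ) ≤ 1 / n := by positivity
    linarith [abs_nonneg ε]
end

section
/- Let γ : [a,b] → ℝ² be a C¹ simple closed curve (γ(a) = γ(b), γ'(a) = γ'(b), γ injective on [a,b), γ'(t) ≠ 0 for all t) which is negatively oriented. Then the total turning of its tangent vector equals −1 full turn: if w̃ : [a,b] → ℝ is a continuous lift of t ↦ γ'(t)/‖γ'(t)‖ through θ ↦ e^{2πiθ}, then w̃(b) − w̃(a) = −1. -/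
open Real

section

open MeasureTheory Set Filter Topology Metric
open Complex (I)

lemma integrableOn_inv_sub_ball (z : ℂ) (R : ℝ) :
    IntegrableOn (fun q : ℂ => (z - q)⁻¹) (ball 0 R) := by
  have hloc : LocallyIntegrable (fun u : ℂ => u⁻¹) volume := by
    refine locallyIntegrable_of_norm_le_rpow (C := 1) (α := 1) ?_ ?_ ?_ ?_
    · simp
    · simp
    · exact .of_forall fun x => by simp [Real.rpow_neg_one]
    · exact measurable_inv.aestronglyMeasurable
  have h2 : IntegrableOn (fun u : ℂ => u⁻¹) (closedBall z R) :=
    hloc.integrableOn_isCompact (isCompact_closedBall _ _)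
  have h3 := (integrable_indicator_iff measurableSet_closedBall).2 h2
  have h4 := h3.comp_sub_left z
  have h5 : (fun q => (closedBall z R).indicator (fun u : ℂ => u⁻¹) (z - q))
      = (closedBall (0:ℂ) R).indicator (fun q => (z - q)⁻¹) := by
    ext q
    simp [indicator, mem_closedBall, dist_eq_norm]
  rw [h5, integrable_indicator_iff measurableSet_closedBall] at h4
  exact h4.mono_set ball_subset_closedBall

lemma circleAverage_inv_sub_of_lt {z : ℂ} {r : ℝ} (hr : 0 < r) (h : r < ‖z‖) :
    circleAverage (fun q : ℂ => (z - q)⁻¹) 0 r = z⁻¹ := by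
  have hd : DiffContOnCl ℂ (fun q : ℂ => (z - q)⁻¹) (ball 0 |r|) := by
    apply DifferentiableOn.diffContOnCl
    rw [abs_of_pos hr, closure_ball _ hr.ne']
    intro q hq
    have : z - q ≠ 0 := by
      intro h0
      rw [sub_eq_zero] at h0
      simp [← h0] at hq
      linarith
    fun_prop (disch := assumption)
  simpa using hd.circleAverage

lemma circleAverage_inv_sub_of_gt {z : ℂ} {r : ℝ} (hz : z ≠ 0) (h : ‖z‖ < r) :
    circleAverage (fun q : ℂ => (z - q)⁻¹) 0 r = 0 := by
  have hr : 0 < r := (norm_nonneg z).trans_lt h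
  have hd : DiffContOnCl ℂ (fun _ : ℂ => (1:ℂ)) (ball 0 |r|) := diffContOnCl_const
  have h1 := hd.circleAverage_smul_div (w := z) (by simpa [abs_of_pos hr] using h)
  have hci : ∀ f : ℂ → ℂ, ContinuousOn f (sphere 0 r) → CircleIntegrable f 0 r :=
    fun f hf => ContinuousOn.circleIntegrable hr.le hf
  have hne : ∀ q ∈ sphere (0:ℂ) r, z - q ≠ 0 := by
    intro q hq h0
    rw [sub_eq_zero] at h0
    simp [← h0] at hq
    linarith
  have hc : ContinuousOn (fun q : ℂ => (z - q)⁻¹) (sphere 0 r) :=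
    ContinuousOn.inv₀ (by fun_prop) hne
  have h2 : circleAverage (fun q : ℂ => ((q - 0) / (q - z)) • (1:ℂ)) 0 r
      = circleAverage ((fun _ : ℂ => (1:ℂ)) + (-z) • (fun q : ℂ => (z - q)⁻¹)) 0 r := by
    apply circleAverage_congr_sphere
    intro q hq
    rw [abs_of_pos hr] at hq
    have := hne q hq
    have h' : q - z ≠ 0 := by rwa [← neg_sub, neg_ne_zero]
    simp
    field_simp
    ring
  rw [h2, circleAverage_add (circleIntegrable_const ..) ((hci _ hc).const_smul),
    circleAverage_const, circleAverage_smul] at h1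
  simpa [hz] using h1

lemma integrable_polarCoord {f : ℂ → ℂ} (hf : Integrable f)
    (hm' : Measurable f) :
    IntegrableOn (fun p : ℝ × ℝ => p.1 • f (Complex.polarCoord.symm p)) polarCoord.target := by
  refine ⟨?_, ?_⟩
  · apply Measurable.aestronglyMeasurable
    have : Measurable fun p : ℝ × ℝ => Complex.polarCoord.symm p := by
      simp only [Complex.polarCoord_symm_apply]
      fun_prop
    exact measurable_fst.smul (hm'.comp this)
  · have h := hf.2
    rw [hasFiniteIntegral_iff_enorm] at h ⊢
    rw [← Complex.lintegral_comp_polarCoord_symm] at h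
    refine lt_of_le_of_lt (le_of_eq ?_) h
    apply setLIntegral_congr_fun polarCoord.open_target.measurableSet
    intro p hp
    have : 0 < p.1 := by simpa using hp.1
    simp only [enorm_smul, Real.enorm_eq_ofReal this.le, smul_eq_mul]

lemma integral_circle_inv_sub (z : ℂ) (r : ℝ) :
    ∫ θ in Ioo (-π) π, (z - circleMap 0 r θ)⁻¹ =
      (2 * π) • circleAverage (fun q : ℂ => (z - q)⁻¹) 0 r := by
  rw [circleAverage_def, smul_inv_smul₀ (by positivity), ← integral_Ioc_eq_integral_Ioo,
    ← intervalIntegral.integral_of_le (by linarith [Real.pi_pos])]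
  have hp : Function.Periodic (fun θ => (z - circleMap 0 r θ)⁻¹) (2 * π) := fun θ => by
    simp [periodic_circleMap 0 r θ]
  have := hp.intervalIntegral_add_eq (-π) 0
  rw [show -π + 2 * π = π by ring, zero_add] at this
  exact this

lemma integral_ball_inv_sub {z : ℂ} {R : ℝ} (hz : ‖z‖ < R) :
    ∫ q in ball (0 : ℂ) R, (z - q)⁻¹ = π * (starRingEnd ℂ) z := by
  rcases eq_or_ne z 0 with rfl | hz0
  · have h := integral_neg_eq_self (fun q => (ball (0:ℂ) R).indicator (fun q => (0 - q)⁻¹) q) volume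
    have h2 : ∀ q, (ball (0:ℂ) R).indicator (fun q => (0 - q)⁻¹) (-q)
        = - (ball (0:ℂ) R).indicator (fun q => (0 - q)⁻¹) q := by
      intro q
      by_cases hq : ‖q‖ < R <;> simp [indicator, hq, inv_neg]
    simp only [h2] at h
    rw [integral_neg, integral_indicator measurableSet_ball] at h
    simpa using self_eq_neg.1 h.symm
  rw [← integral_indicator measurableSet_ball, ← Complex.integral_comp_polarCoord_symm]
  have hint := (integrable_indicator_iff measurableSet_ball).2 (integrableOn_inv_sub_ball z R)
  have hm : Measurable ((ball (0:ℂ) R).indicator fun q => (z - q)⁻¹) :=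
    (by fun_prop : Measurable fun q => (z - q)⁻¹).indicator measurableSet_ball
  have hI := integrable_polarCoord hint hm
  have ht : polarCoord.target = Ioi (0:ℝ) ×ˢ Ioo (-π) π := rfl
  rw [ht] at hI ⊢
  rw [Measure.volume_eq_prod] at hI ⊢
  rw [setIntegral_prod _ hI]
  have key : ∀ᵐ r : ℝ, r ∈ Ioi (0:ℝ) → (∫ θ in Ioo (-π) π, (r, θ).1 •
      (ball (0:ℂ) R).indicator (fun q => (z - q)⁻¹) (Complex.polarCoord.symm (r, θ)))
      = (Ioo 0 ‖z‖).indicator (fun r : ℝ => (r : ℂ) * (2 * π / z)) r := by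
    have : ∀ᵐ r : ℝ, r ≠ ‖z‖ := by simp [ae_iff]
    filter_upwards [this] with r hrz hr
    have hr : 0 < r := hr
    have e : ∀ θ, (r, θ).1 • (ball (0:ℂ) R).indicator (fun q => (z - q)⁻¹)
        (Complex.polarCoord.symm (r, θ)) =
        (if r < R then (r:ℂ) else 0) * (z - circleMap 0 r θ)⁻¹ := by
      intro θ
      have : Complex.polarCoord.symm (r, θ) = circleMap 0 r θ := by
        simp [circleMap, Complex.exp_mul_I]
      rw [this]
      by_cases h : r < R <;> simp [indicator, h, abs_of_pos hr]
    simp only [e]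
    rw [integral_const_mul, integral_circle_inv_sub]
    rcases lt_or_gt_of_ne hrz with h | h
    · rw [circleAverage_inv_sub_of_lt hr h]
      simp [h, hr, h.trans hz, indicator]
      left; field_simp
    · rw [circleAverage_inv_sub_of_gt hz0 h]
      simp [indicator, h.le]
  rw [setIntegral_congr_ae measurableSet_Ioi key, setIntegral_indicator measurableSet_Ioo,
    inter_eq_self_of_subset_right Ioo_subset_Ioi_self, integral_mul_const,
    ← integral_Ioc_eq_integral_Ioo, ← intervalIntegral.integral_of_le (norm_nonneg z),
    intervalIntegral.integral_ofReal, integral_id]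
  have : ((‖z‖ : ℂ))^2 = z * (starRingEnd ℂ) z := by rw [Complex.mul_conj']
  push_cast
  rw [this]
  field_simp
  ring

/-- A `C¹` regular simple closed curve in `ℂ`, given as a `T`-periodic function `g` together with
its derivative `g'`. -/
structure IsSimpleClosedCurve (g g' : ℝ → ℂ) (T : ℝ) : Prop where
  pos : 0 < T
  hasDerivAt : ∀ t, HasDerivAt g (g' t) t
  continuous_deriv : Continuous g'
  periodic : Function.Periodic g T
  periodic_deriv : Function.Periodic g' T
  ne : ∀ s t, s < t → t < s + T → g s ≠ g t
  deriv_ne : ∀ t, g' t ≠ 0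

/-- `2π` times the winding number around `q` of the closed curve `g : [0, T] → ℂ`. -/
noncomputable def windingAngle (g g' : ℝ → ℂ) (T : ℝ) (q : ℂ) : ℝ :=
  (∫ t in 0..T, g' t / (g t - q)).im

lemma eqOn_of_forall_int_mul {X : Type*} [TopologicalSpace X] {S : Set X} (hS : IsPreconnected S)
    {f : X → ℝ} (hf : ContinuousOn f S) {c : ℝ} (hc : c ≠ 0) (h : ∀ x ∈ S, ∃ n : ℤ, f x = n * c)
    {x y : X} (hx : x ∈ S) (hy : y ∈ S) : f x = f y := by
  have hd : IsDiscrete (range ((↑) : ℤ → ℝ)) := by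
    rw [isDiscrete_iff_discreteTopology]
    exact Real.isClosedEmbedding_intCast.isEmbedding.toHomeomorph.discreteTopology
  have := hS.constant_of_mapsTo hd (f := fun x => f x / c) (hf.div_const c)
    (fun x hx => by
      obtain ⟨n, hn⟩ := h x hx
      exact ⟨n, by simp [hn, hc]⟩) hx hy
  simpa [hc, div_left_inj'] using this

namespace IsSimpleClosedCurve

variable {g g' : ℝ → ℂ} {T : ℝ}

lemma continuous (h : IsSimpleClosedCurve g g' T) : Continuous g :=
  continuous_iff_continuousAt.2 fun t => (h.hasDerivAt t).continuousAt

lemma exists_shift (h : IsSimpleClosedCurve g g' T) (s t : ℝ) :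
    ∃ s' ∈ Ico 0 T, ∃ t', t' - s' = t - s ∧ g s' = g s ∧ g' s' = g' s ∧ g t' = g t ∧
      g' t' = g' t := by
  refine ⟨s - toIcoDiv h.pos 0 s • T, ?_, t - toIcoDiv h.pos 0 s • T, by ring,
    h.periodic.sub_zsmul_eq _, h.periodic_deriv.sub_zsmul_eq _, h.periodic.sub_zsmul_eq _,
    h.periodic_deriv.sub_zsmul_eq _⟩
  simpa using sub_toIcoDiv_zsmul_mem_Ico h.pos 0 s

lemma exists_deriv_lower_bound (h : IsSimpleClosedCurve g g' T) : ∃ m > 0, ∀ t, m ≤ ‖g' t‖ := by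
  obtain ⟨m, hm, hm'⟩ := (isCompact_Icc (a := 0) (b := T)).exists_forall_le'
    h.continuous_deriv.norm.continuousOn (a := 0) (fun t _ => norm_pos_iff.2 (h.deriv_ne t))
  refine ⟨m, hm, fun t => ?_⟩
  obtain ⟨s, hs, -, -, -, h2, -⟩ := h.exists_shift t t
  rw [← h2]
  exact hm' s (Ico_subset_Icc_self hs)

lemma exists_deriv_upper_bound (h : IsSimpleClosedCurve g g' T) : ∃ M > 0, ∀ t, ‖g' t‖ ≤ M := by
  obtain ⟨M, hM⟩ := (isCompact_Icc (a := 0) (b := T)).exists_bound_of_continuousOn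
    h.continuous_deriv.continuousOn
  refine ⟨max M 1, by positivity, fun t => ?_⟩
  obtain ⟨s, hs, -, -, -, h2, -⟩ := h.exists_shift t t
  rw [← h2]
  exact (hM s (Ico_subset_Icc_self hs)).trans (le_max_left _ _)

lemma exists_norm_bound (h : IsSimpleClosedCurve g g' T) : ∃ R > 0, ∀ t, ‖g t‖ < R := by
  obtain ⟨M, hM⟩ := (isCompact_Icc (a := 0) (b := T)).exists_bound_of_continuousOn
    h.continuous.continuousOn
  refine ⟨max M 0 + 1, by positivity, fun t => ?_⟩
  obtain ⟨s, hs, -, -, h2, -⟩ := h.exists_shift t t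
  rw [← h2]
  linarith [hM s (Ico_subset_Icc_self hs), le_max_left M 0]

lemma ne_of_abs_sub_le (h : IsSimpleClosedCurve g g' T) {s t : ℝ} (hst : s ≠ t)
    (hT : |t - s| ≤ T / 2) : g s ≠ g t := by
  have := h.pos
  rw [abs_le] at hT
  rcases lt_or_gt_of_ne hst with h1 | h1
  · exact h.ne s t h1 (by linarith)
  · exact (h.ne t s h1 (by linarith)).symm

/-- Points of the curve with well separated parameters are uniformly far apart. -/
lemma exists_separation (h : IsSimpleClosedCurve g g' T) {r : ℝ} (hr : 0 < r) :
    ∃ c > 0, ∀ s t, r ≤ |t - s| → |t - s| ≤ T / 2 → c ≤ ‖g t - g s‖ := by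
  have hK : IsCompact {p : ℝ × ℝ | p ∈ Icc 0 T ×ˢ Icc (-T) (2 * T) ∧ r ≤ |p.2 - p.1| ∧
      |p.2 - p.1| ≤ T / 2} := by
    refine (isCompact_Icc.prod isCompact_Icc).inter_right ?_
    have hcont : Continuous fun p : ℝ × ℝ => |p.2 - p.1| := by fun_prop
    exact (isClosed_le continuous_const hcont).inter (isClosed_le hcont continuous_const)
  have hc := h.continuous
  obtain ⟨c, hc, hc'⟩ := hK.exists_forall_le' (f := fun p => ‖g p.2 - g p.1‖) (by fun_prop) (a := 0)
    (by
      rintro ⟨s, t⟩ ⟨-, h1, h2⟩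
      refine norm_pos_iff.2 (sub_ne_zero.2 (h.ne_of_abs_sub_le ?_ h2).symm)
      intro (e : s = t)
      simp [e] at h1
      linarith)
  refine ⟨c, hc, fun s t h1 h2 => ?_⟩
  obtain ⟨s', hs', t', e, e1, -, e2, -⟩ := h.exists_shift s t
  rw [← e1, ← e2]
  rw [← e] at h1 h2
  refine hc' (s', t') ⟨⟨Ico_subset_Icc_self hs', ?_⟩, h1, h2⟩
  rw [abs_le] at h2
  have := h.pos
  constructor <;> simp only <;> linarith [hs'.1, hs'.2]

lemma exists_near (h : IsSimpleClosedCurve g g' T) :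
    ∃ r > 0, ∀ s t, |t - s| < r → ‖g' t - g' s‖ ≤ 1 / 8 * ‖g' s‖ ∧
      ‖g t - g s - (t - s) • g' s‖ ≤ 1 / 8 * ‖g' s‖ * |t - s| := by
  obtain ⟨m, hm, hm'⟩ := h.exists_deriv_lower_bound
  have hT := h.pos
  have huc := (isCompact_Icc (a := -T) (b := 2 * T)).uniformContinuousOn_of_continuous
    h.continuous_deriv.continuousOn
  rw [Metric.uniformContinuousOn_iff_le] at huc
  obtain ⟨d, hd, hd'⟩ := huc (1 / 8 * m) (by positivity)
  have key : ∀ s t, |t - s| < min d T → ‖g' t - g' s‖ ≤ 1 / 8 * ‖g' s‖ := by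
    intro s t hst
    obtain ⟨s', hs', t', e, -, e1, -, e2⟩ := h.exists_shift s t
    rw [← e1, ← e2]
    rw [← e, lt_min_iff] at hst
    have h2 := abs_lt.1 hst.2
    have := hd' t' ⟨by linarith [hs'.1, hs'.2], by linarith [hs'.1, hs'.2]⟩ s'
      ⟨by linarith [hs'.1, hs'.2], by linarith [hs'.1, hs'.2]⟩ hst.1.le
    rw [dist_eq_norm] at this
    linarith [hm' s']
  refine ⟨min d T, by positivity, fun s t hst => ⟨key s t hst, ?_⟩⟩
  have := (convex_uIcc s t).norm_image_sub_le_of_norm_hasDerivWithin_le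
    (f := fun x => g x - (x - s) • g' s) (f' := fun x => g' x - g' s)
    (C := 1 / 8 * ‖g' s‖) (x := s) (y := t) ?_ ?_ left_mem_uIcc right_mem_uIcc
  · simp only [sub_self, zero_smul, sub_zero] at this
    rw [Real.norm_eq_abs] at this
    rwa [sub_right_comm] at this
  · intro x _
    have h1 := ((hasDerivAt_id x).sub_const s).smul_const (g' s)
    rw [one_smul] at h1
    exact ((h.hasDerivAt x).sub h1).hasDerivWithinAt
  · intro x hx
    apply key
    refine lt_of_le_of_lt ?_ hst
    have := abs_sub_left_of_mem_uIcc hx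
    simpa [abs_sub_comm] using this

/-- A uniform tube around the curve: short normal segments only meet the curve at their foot. -/
lemma exists_tube (h : IsSimpleClosedCurve g g' T) :
    ∃ d > 0, ∀ s u : ℝ, u ≠ 0 → |u| ≤ d → g s + u * I * g' s ∉ range g := by
  obtain ⟨r, hr, hr'⟩ := h.exists_near
  obtain ⟨c, hc, hc'⟩ := h.exists_separation hr
  obtain ⟨M, hM, hM'⟩ := h.exists_deriv_upper_bound
  refine ⟨c / (2 * M), by positivity, ?_⟩
  rintro s u hu hud ⟨t0, ht0⟩
  obtain ⟨t, ht, e⟩ : ∃ t, |t - s| ≤ T / 2 ∧ g t = g t0 := by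
    have := h.pos
    refine ⟨t0 - toIcoDiv h.pos (s - T / 2) t0 • T, ?_, h.periodic.sub_zsmul_eq _⟩
    have := sub_toIcoDiv_zsmul_mem_Ico h.pos (s - T / 2) t0
    rw [abs_le]
    constructor <;> linarith [this.1, this.2]
  rw [← e] at ht0
  rcases lt_or_ge |t - s| r with h1 | h1
  · have h2 := (hr' s t h1).2
    have h3 : g t - g s - (t - s) • g' s = (u * I - ((t - s : ℝ) : ℂ)) * g' s := by
      rw [ht0, Complex.real_smul]; ring
    rw [h3, norm_mul] at h2
    have h4 : 0 < ‖g' s‖ := norm_pos_iff.2 (h.deriv_ne s)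
    have h5 : |t - s| ≤ ‖(u * I - ((t - s : ℝ) : ℂ))‖ := by
      have := Complex.abs_re_le_norm (u * I - ((t - s : ℝ) : ℂ))
      rw [← abs_neg (t - s)]
      simpa using this
    have h5' : |u| ≤ ‖(u * I - ((t - s : ℝ) : ℂ))‖ := by
      have := Complex.abs_im_le_norm (u * I - ((t - s : ℝ) : ℂ))
      simpa using this
    have h6 : ‖(u * I - ((t - s : ℝ) : ℂ))‖ ≤ 1 / 8 * |t - s| := by
      refine le_of_mul_le_mul_right ?_ h4
      linarith
    have : 0 < |u| := abs_pos.2 hu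
    linarith
  · have h2 := hc' s t h1 ht
    rw [ht0, add_sub_cancel_left, norm_mul, norm_mul] at h2
    simp only [Complex.norm_real, Complex.norm_I, mul_one, Real.norm_eq_abs] at h2
    have : |u| * ‖g' s‖ ≤ c / (2 * M) * M := by
      gcongr
      exact hM' s
    have e : c / (2 * M) * M = c / 2 := by field_simp
    linarith

lemma sub_ne_zero_of_notMem (g : ℝ → ℂ) {q : ℂ} (hq : q ∉ range g) (t : ℝ) : g t - q ≠ 0 :=
  fun h0 => hq ⟨t, sub_eq_zero.1 h0⟩

lemma continuous_integrand (h : IsSimpleClosedCurve g g' T) {q : ℂ} (hq : q ∉ range g) :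
    Continuous fun t => g' t / (g t - q) :=
  h.continuous_deriv.div (h.continuous.sub continuous_const) (sub_ne_zero_of_notMem g hq)

lemma exists_windingAngle_eq (h : IsSimpleClosedCurve g g' T) {q : ℂ} (hq : q ∉ range g) :
    ∃ n : ℤ, windingAngle g g' T q = n * (2 * π) := by
  have hc := h.continuous_integrand hq
  set F : ℝ → ℂ := fun x => ∫ t in 0..x, g' t / (g t - q) with hF
  have hFd : ∀ x, HasDerivAt F (g' x / (g x - q)) x := fun x =>
    hc.integral_hasStrictDerivAt 0 x |>.hasDerivAt
  have hG : ∀ x, HasDerivAt (fun x => Complex.exp (-F x) * (g x - q)) 0 x := by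
    intro x
    have h1 := ((hFd x).neg.cexp).mul ((h.hasDerivAt x).sub_const q)
    refine h1.congr_deriv ?_
    have := sub_ne_zero_of_notMem g hq x
    field_simp
    ring
  have hconst := is_const_of_deriv_eq_zero (fun x => (hG x).differentiableAt)
    (fun x => (hG x).deriv) T 0
  have h0 : F 0 = 0 := by simp [hF]
  have hT : g T = g 0 := by simpa using h.periodic 0
  rw [h0, hT] at hconst
  have hne := sub_ne_zero_of_notMem g hq 0
  have he := mul_right_cancel₀ hne hconst
  rw [neg_zero, Complex.exp_zero, Complex.exp_eq_one_iff] at he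
  obtain ⟨n, hn⟩ := he
  refine ⟨-n, ?_⟩
  have : F T = -(n * (2 * π * I)) := by rw [← hn, neg_neg]
  rw [windingAngle]
  change (F T).im = _
  rw [this]
  simp

lemma continuousOn_windingAngle (h : IsSimpleClosedCurve g g' T) :
    ContinuousOn (windingAngle g g' T) (range g)ᶜ := by
  rw [continuousOn_iff_continuous_domRestrict]
  refine Complex.continuous_im.comp
    (intervalIntegral.continuous_parametric_intervalIntegral_of_continuous'
      (f := fun (q : ((range g)ᶜ : Set ℂ)) t => g' t / (g t - q)) ?_ 0 T)
  refine Continuous.div (h.continuous_deriv.comp continuous_snd)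
    ((h.continuous.comp continuous_snd).sub (continuous_subtype_val.comp continuous_fst)) ?_
  rintro ⟨q, t⟩
  exact sub_ne_zero_of_notMem g q.2 t

lemma windingAngle_eq_of_isPreconnected (h : IsSimpleClosedCurve g g' T) {S : Set ℂ}
    (hS : IsPreconnected S) (hSg : S ⊆ (range g)ᶜ) {p q : ℂ} (hp : p ∈ S) (hq : q ∈ S) :
    windingAngle g g' T p = windingAngle g g' T q :=
  eqOn_of_forall_int_mul hS (h.continuousOn_windingAngle.mono hSg) (by positivity)
    (fun _ hx => h.exists_windingAngle_eq (hSg hx)) hp hq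

lemma windingAngle_eq_zero_of_im_pos (h : IsSimpleClosedCurve g g' T) {q : ℂ}
    (hq : ∀ t, q.im < (g t).im) : windingAngle g g' T q = 0 := by
  have hq' : q ∉ range g := by
    rintro ⟨t, rfl⟩
    exact lt_irrefl _ (hq t)
  have hd : ∀ t ∈ uIcc 0 T, HasDerivAt (fun t => Complex.log (-I * (g t - q)))
      (g' t / (g t - q)) t := by
    intro t _
    have h1 := ((h.hasDerivAt t).sub_const q).const_mul (-I)
    have h2 := h1.clog_real (Or.inl (by simpa using hq t))
    convert h2 using 1
    rw [mul_div_mul_left _ _ (by simp)]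
  rw [windingAngle, intervalIntegral.integral_eq_sub_of_hasDerivAt hd
    ((h.continuous_integrand hq').intervalIntegrable _ _)]
  have hT : g T = g 0 := by simpa using h.periodic 0
  simp [hT]

lemma re_div_nonneg_of_near {A w : ℂ} {x d : ℝ} (hA : ‖A - 1‖ ≤ 1 / 8)
    (hw : ‖w - x‖ ≤ 1 / 8 * |x|) : 0 ≤ (A / (w ^ 2 + d ^ 2)).re := by
  obtain ⟨e, he, rfl⟩ : ∃ e : ℂ, ‖e‖ ≤ 1 / 8 ∧ w = x * (1 + e) := by
    rcases eq_or_ne x 0 with rfl | hx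
    · refine ⟨0, by norm_num, ?_⟩
      simpa using hw
    · have hx' : (x : ℂ) ≠ 0 := by exact_mod_cast hx
      refine ⟨(w - x) / x, ?_, by field_simp; ring⟩
      rw [norm_div, Complex.norm_real, Real.norm_eq_abs, div_le_iff₀ (abs_pos.2 hx)]
      exact hw
  have hAr : 0 ≤ A.re := by
    have := (abs_le.1 ((Complex.abs_re_le_norm (A - 1)).trans hA)).1
    simp at this
    linarith
  have key : 0 ≤ (A * (starRingEnd ℂ) ((1 + e) ^ 2)).re := by
    set f := (starRingEnd ℂ) e with hf
    have hfe : ‖f‖ ≤ 1 / 8 := by rwa [hf, RCLike.norm_conj]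
    have h1 : A * (starRingEnd ℂ) ((1 + e) ^ 2) - 1
        = (A - 1) + ((A - 1) + 1) * (2 * f + f ^ 2) := by
      simp only [map_pow, map_add, map_one, ← hf]; ring
    have h2 : ‖A * (starRingEnd ℂ) ((1 + e) ^ 2) - 1‖ ≤ 1 := by
      rw [h1]
      calc _ ≤ ‖A - 1‖ + ‖((A - 1) + 1) * (2 * f + f ^ 2)‖ := norm_add_le _ _
        _ ≤ ‖A - 1‖ + (‖A - 1‖ + 1) * (2 * ‖f‖ + ‖f‖ ^ 2) := by
          rw [norm_mul]
          gcongr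
          · exact (norm_add_le _ _).trans (by simp)
          · exact (norm_add_le _ _).trans (by simp)
        _ ≤ 1 / 8 + (1 / 8 + 1) * (2 * (1 / 8) + (1 / 8) ^ 2) := by gcongr
        _ ≤ 1 := by norm_num
    have := (abs_le.1 ((Complex.abs_re_le_norm _).trans h2)).1
    simp only [Complex.sub_re, Complex.one_re] at this
    linarith
  rw [div_eq_mul_inv, Complex.inv_def, ← mul_assoc, Complex.re_mul_ofReal]
  refine mul_nonneg ?_ (inv_nonneg.2 (Complex.normSq_nonneg _))
  have h3 : A * (starRingEnd ℂ) ((x * (1 + e)) ^ 2 + (d : ℂ) ^ 2)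
      = ((x ^ 2 : ℝ) : ℂ) * (A * (starRingEnd ℂ) ((1 + e) ^ 2)) + ((d ^ 2 : ℝ) : ℂ) * A := by
    simp only [map_pow, map_add, map_mul, map_one, Complex.conj_ofReal]
    push_cast
    ring
  rw [h3, Complex.add_re, Complex.re_ofReal_mul, Complex.re_ofReal_mul]
  positivity

lemma windingAngle_eq_integral (h : IsSimpleClosedCurve g g' T) (q : ℂ) (a : ℝ) :
    windingAngle g g' T q = (∫ t in a..(a + T), g' t / (g t - q)).im := by
  have hp : Function.Periodic (fun t => g' t / (g t - q)) T := fun t => by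
    simp [h.periodic t, h.periodic_deriv t]
  rw [windingAngle, ← hp.intervalIntegral_add_eq 0 a, zero_add]

/-- The winding number does not decrease when crossing the curve from right to left. -/
lemma exists_windingAngle_jump (h : IsSimpleClosedCurve g g' T) (s : ℝ) :
    ∃ d > 0, ∀ u : ℝ, 0 < u → u ≤ d →
      -(2 * π) < windingAngle g g' T (g s + u * I * g' s)
        - windingAngle g g' T (g s + (-u : ℝ) * I * g' s) := by
  obtain ⟨r, hr, hr'⟩ := h.exists_near
  obtain ⟨c, hc, hc'⟩ := h.exists_separation hr
  obtain ⟨M, hM, hM'⟩ := h.exists_deriv_upper_bound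
  obtain ⟨d, hd, hd'⟩ := h.exists_tube
  have hT := h.pos
  set K : ℝ := 8 * M ^ 2 / c ^ 2 with hK
  have hKpos : 0 < K := by positivity
  set v := g' s with hv
  have hv0 : v ≠ 0 := h.deriv_ne s
  refine ⟨min d (min (c / (2 * M)) (π / (K * T))), by positivity, fun u hu hud => ?_⟩
  have hud1 : u ≤ d := hud.trans (min_le_left _ _)
  have hud2 : u ≤ c / (2 * M) := hud.trans ((min_le_right _ _).trans (min_le_left _ _))
  have hud3 : u ≤ π / (K * T) := hud.trans ((min_le_right _ _).trans (min_le_right _ _))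
  have hq1 := hd' s u hu.ne' (by rwa [abs_of_pos hu])
  have hq2 := hd' s (-u) (by linarith) (by rwa [abs_neg, abs_of_pos hu])
  have hpt : ∀ t ∈ Icc (s - T / 2) (s - T / 2 + T), -(u * K) ≤
      (g' t / (g t - (g s + u * I * v)) - g' t / (g t - (g s + (-u : ℝ) * I * v))).im := by
    intro t ht
    have hts : |t - s| ≤ T / 2 := by
      rw [abs_le]; constructor <;> linarith [ht.1, ht.2]
    have n1 := sub_ne_zero_of_notMem g hq1 t
    have n2 := sub_ne_zero_of_notMem g hq2 t
    set D := g t - g s with hD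
    have e1 : g t - (g s + u * I * v) = D - u * I * v := by rw [hD]; ring
    have e2 : g t - (g s + (-u : ℝ) * I * v) = D + u * I * v := by rw [hD]; push_cast; ring
    rw [e1] at n1 ⊢
    rw [e2] at n2 ⊢
    have hprod : (D - u * I * v) * (D + u * I * v) = D ^ 2 + u ^ 2 * v ^ 2 := by
      linear_combination -(u : ℂ) ^ 2 * v ^ 2 * Complex.I_sq
    have n3 : D ^ 2 + u ^ 2 * v ^ 2 ≠ 0 := by rw [← hprod]; exact mul_ne_zero n1 n2
    have e3 : g' t / (D - u * I * v) - g' t / (D + u * I * v)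
        = ((2 * u : ℝ) : ℂ) * (g' t * v / (D ^ 2 + u ^ 2 * v ^ 2)) * I := by
      rw [← hprod]
      field_simp
      push_cast
      ring
    rw [e3, Complex.mul_I_im, Complex.re_ofReal_mul]
    rcases lt_or_ge |t - s| r with h1 | h1
    · have hnear := hr' s t h1
      have hvn : 0 < ‖v‖ := norm_pos_iff.2 hv0
      have e4 : g' t * v / (D ^ 2 + u ^ 2 * v ^ 2) = (g' t / v) / ((D / v) ^ 2 + u ^ 2) := by
        have : (D / v) ^ 2 + u ^ 2 = (D ^ 2 + u ^ 2 * v ^ 2) / v ^ 2 := by field_simp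
        rw [this]
        field_simp
      have := re_div_nonneg_of_near (A := g' t / v) (w := D / v) (x := t - s) (d := u) ?_ ?_
      · rw [e4]
        have h5 : 0 < u * K := by positivity
        have h6 := mul_nonneg (by positivity : 0 ≤ 2 * u) this
        linarith
      · rw [div_sub_one hv0, norm_div, div_le_iff₀ hvn]
        exact hnear.1
      · have : D / v - ((t - s : ℝ) : ℂ) = (D - (t - s) • v) / v := by
          rw [Complex.real_smul]; field_simp
        rw [this, norm_div, div_le_iff₀ hvn]
        linarith [hnear.2]
    · have hDc : c ≤ ‖D‖ := hc' s t h1 hts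
      have hn : ‖(u : ℂ) * I * v‖ ≤ c / 2 := by
        rw [norm_mul, norm_mul, Complex.norm_real, Complex.norm_I, mul_one, Real.norm_eq_abs,
          abs_of_pos hu]
        calc u * ‖v‖ ≤ c / (2 * M) * M := by gcongr; exact hM' s
          _ = c / 2 := by field_simp
      have l1 : c / 2 ≤ ‖D - u * I * v‖ := by
        have := norm_sub_norm_le D (u * I * v); linarith
      have l2 : c / 2 ≤ ‖D + u * I * v‖ := by
        have := norm_sub_norm_le D (-(u * I * v)); rw [norm_neg, sub_neg_eq_add] at this; linarith
      have l3 : ‖g' t * v / (D ^ 2 + u ^ 2 * v ^ 2)‖ ≤ M * M / (c / 2 * (c / 2)) := by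
        rw [← hprod, norm_div, norm_mul, norm_mul]
        gcongr
        · exact hM' t
        · exact hM' s
      have l4 := (abs_le.1 ((Complex.abs_re_le_norm _).trans l3)).1
      have l5 : M * M / (c / 2 * (c / 2)) = K / 2 := by rw [hK]; field_simp; ring
      rw [l5] at l4
      have := mul_le_mul_of_nonneg_left l4 (by positivity : 0 ≤ 2 * u)
      linarith
  rw [h.windingAngle_eq_integral _ (s - T / 2), h.windingAngle_eq_integral _ (s - T / 2),
    ← Complex.sub_im]
  have c1 := h.continuous_integrand hq1
  have c2 := h.continuous_integrand hq2
  rw [← intervalIntegral.integral_sub (c1.intervalIntegrable _ _) (c2.intervalIntegrable _ _)]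
  have e5 := Complex.imCLM.intervalIntegral_comp_comm
    ((c1.sub c2).intervalIntegrable (μ := volume) (s - T / 2) (s - T / 2 + T))
  simp only [Complex.imCLM_apply, Pi.sub_apply] at e5
  rw [← e5]
  have hle := intervalIntegral.integral_mono_on (μ := volume) (f := fun _ => -(u * K))
    (by linarith : s - T / 2 ≤ s - T / 2 + T) (by simp)
    ((Complex.continuous_im.comp (c1.sub c2)).intervalIntegrable _ _) hpt
  simp only [intervalIntegral.integral_const, smul_eq_mul, add_sub_cancel_left] at hle
  refine lt_of_lt_of_le ?_ hle
  have : u * (K * T) ≤ π := (le_div_iff₀ (by positivity)).1 hud3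
  nlinarith [Real.pi_pos]

lemma windingAngle_nonneg (h : IsSimpleClosedCurve g g' T) {s₀ : ℝ}
    (hmin : ∀ t, (g s₀).im ≤ (g t).im) (hre : 0 < (g' s₀).re) (him : (g' s₀).im = 0)
    {q : ℂ} (hq : q ∉ range g) : 0 ≤ windingAngle g g' T q := by
  obtain ⟨d, hd, hd'⟩ := h.exists_tube
  have hg := h.continuous
  have hg' := h.continuous_deriv
  set ν : ℝ × ℝ → ℂ := fun p => g p.1 + p.2 * I * g' p.1 with hν
  have hνc : Continuous ν := by
    rw [hν]
    fun_prop
  have side : ∀ J : Set ℝ, IsPreconnected J → (∀ u ∈ J, u ≠ 0 ∧ |u| ≤ d) → ∀ s t : ℝ,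
      ∀ u ∈ J, ∀ v ∈ J, windingAngle g g' T (ν (s, u)) = windingAngle g g' T (ν (t, v)) := by
    intro J hJ hJ' s t u hu v hv
    refine h.windingAngle_eq_of_isPreconnected (S := ν '' (univ ×ˢ J))
      ((isPreconnected_univ.prod hJ).image _ hνc.continuousOn) ?_ ⟨(s, u), by simpa using hu, rfl⟩
      ⟨(t, v), by simpa using hv, rfl⟩
    rintro _ ⟨⟨s, u⟩, ⟨-, hu⟩, rfl⟩
    exact hd' s u (hJ' u hu).1 (hJ' u hu).2
  have right : ∀ s u, u ∈ Ico (-d) 0 → windingAngle g g' T (ν (s, u)) = 0 := by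
    intro s u hu
    rw [side (Ico (-d) 0) isPreconnected_Ico (fun u hu => ⟨hu.2.ne, abs_le.2 ⟨hu.1, by
      linarith [hu.2]⟩⟩) s s₀ u hu (-d) (by simpa using hd)]
    apply h.windingAngle_eq_zero_of_im_pos
    intro t
    have : 0 < d * (g' s₀).re := by positivity
    have h2 := hmin t
    simp [hν, him]
    linarith
  have left : ∀ s u, u ∈ Ioc 0 d → 0 ≤ windingAngle g g' T (ν (s, u)) := by
    intro s u hu
    obtain ⟨e, he, he'⟩ := h.exists_windingAngle_jump s
    have hm : 0 < min d e := by positivity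
    rw [side (Ioc 0 d) isPreconnected_Ioc (fun u hu => ⟨hu.1.ne', abs_le.2 ⟨by
      linarith [hu.1], hu.2⟩⟩) s s u hu (min d e) ⟨hm, min_le_left _ _⟩]
    have h1 := he' (min d e) hm (min_le_right _ _)
    have h2 := right s (-(min d e)) ⟨by linarith [min_le_left d e], by linarith⟩
    obtain ⟨n, hn⟩ := h.exists_windingAngle_eq (q := ν (s, min d e))
      (hd' s _ hm.ne' (by rw [abs_of_pos hm]; exact min_le_left _ _))
    simp only [hν] at h2 hn ⊢
    rw [h2, hn, sub_zero] at h1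
    rw [hn]
    have h3 : (-1 : ℝ) < n := by
      have : (-1 : ℝ) * (2 * π) < n * (2 * π) := by linarith
      exact lt_of_mul_lt_mul_right this (by positivity)
    have h4 : (0 : ℤ) ≤ n := by
      have : (-1 : ℤ) < n := by exact_mod_cast h3
      omega
    have : (0 : ℝ) ≤ n := by exact_mod_cast h4
    positivity
  -- the foot of the perpendicular from `q`
  obtain ⟨s, -, hs⟩ := (isCompact_Icc (a := 0) (b := T)).exists_isMinOn
    (nonempty_Icc.2 h.pos.le) (f := fun t => ‖g t - q‖) (by fun_prop)
  have hs' : ∀ t, ‖g s - q‖ ≤ ‖g t - q‖ := by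
    intro t
    obtain ⟨t', ht', -, -, e, -⟩ := h.exists_shift t t
    rw [← e]
    exact hs (Ico_subset_Icc_self ht')
  have hperp : (starRingEnd ℂ (g' s) * (q - g s)).re = 0 := by
    have hd1 : HasDerivAt (fun t => ‖g t - q‖ ^ 2) (2 * inner ℝ (g s - q) (g' s)) s :=
      ((h.hasDerivAt s).sub_const q).norm_sq
    have hl : IsLocalMin (fun t => ‖g t - q‖ ^ 2) s :=
      .of_forall fun t => pow_le_pow_left₀ (norm_nonneg _) (hs' t) 2
    have h0 := hl.hasDerivAt_eq_zero hd1
    rw [Complex.inner] at h0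
    simp only [Complex.mul_re, Complex.conj_re, Complex.conj_im, Complex.sub_re,
      Complex.sub_im] at h0 ⊢
    linarith
  have hv0 := h.deriv_ne s
  set u : ℝ := ((q - g s) / g' s).im with hu
  have hqu : q = ν (s, u) := by
    have hre0 : ((q - g s) / g' s).re = 0 := by
      rw [div_eq_mul_inv, Complex.inv_def, ← mul_assoc, Complex.re_mul_ofReal, mul_comm (q - g s),
        hperp, zero_mul]
    have h1 : (q - g s) / g' s = u * I := by
      apply Complex.ext <;> simp [hre0, hu]
    rw [div_eq_iff hv0] at h1
    simp only [hν]
    linear_combination h1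
  have hu0 : u ≠ 0 := by
    intro h0
    apply hq
    rw [hqu, h0]
    exact ⟨s, by simp [hν]⟩
  have hoff : ∀ v : ℝ, v ≠ 0 → |u - v| < |u| → ν (s, v) ∉ range g := by
    rintro v - hvu ⟨t, ht⟩
    have h1 := hs' t
    rw [ht, hqu] at h1
    have e1 : g s - ν (s, u) = ((-u : ℝ) : ℂ) * I * g' s := by simp only [hν]; push_cast; ring
    have e2 : ν (s, v) - ν (s, u) = ((v - u : ℝ) : ℂ) * I * g' s := by
      simp only [hν]; push_cast; ring
    rw [e1, e2, norm_mul, norm_mul, norm_mul, norm_mul, Complex.norm_real, Complex.norm_real,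
      Complex.norm_I, mul_one, mul_one, Real.norm_eq_abs, Real.norm_eq_abs, abs_neg,
      abs_sub_comm] at h1
    have := le_of_mul_le_mul_right h1 (norm_pos_iff.2 hv0)
    linarith
  have hνs : Continuous fun v => ν (s, v) := hνc.comp (by fun_prop)
  rcases lt_or_gt_of_ne hu0 with hneg | hpos
  · have := h.windingAngle_eq_of_isPreconnected (S := (fun v => ν (s, v)) '' Ico u 0)
      (p := q) (q := ν (s, max u (-d)))
      (isPreconnected_Ico.image _ hνs.continuousOn) (by
        rintro _ ⟨v, hv, rfl⟩
        rcases eq_or_ne v u with rfl | hvu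
        · simpa [← hqu] using hq
        · refine hoff v hv.2.ne ?_
          rw [abs_of_neg hneg, abs_of_nonpos (by linarith [hv.1])]
          linarith [hv.2]) ⟨u, by simpa using hneg, hqu.symm⟩
      ⟨_, ⟨le_max_left _ _, max_lt hneg (by linarith)⟩, rfl⟩
    rw [this, right s _ ⟨le_max_right _ _, max_lt hneg (by linarith)⟩]
  · have := h.windingAngle_eq_of_isPreconnected (S := (fun v => ν (s, v)) '' Ioc 0 u)
      (p := q) (q := ν (s, min u d))
      (isPreconnected_Ioc.image _ hνs.continuousOn) (by
        rintro _ ⟨v, hv, rfl⟩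
        rcases eq_or_ne v u with rfl | hvu
        · simpa [← hqu] using hq
        · refine hoff v hv.1.ne' ?_
          rw [abs_of_pos hpos, abs_of_nonneg (by linarith [hv.2])]
          linarith [hv.1]) ⟨u, by simpa using hpos, hqu.symm⟩
      ⟨_, ⟨lt_min hpos hd, min_le_left _ _⟩, rfl⟩
    rw [this]
    exact left s _ ⟨lt_min hpos hd, min_le_right _ _⟩

lemma volume_range_eq_zero (h : IsSimpleClosedCurve g g' T) : volume (range g) = 0 := by
  have h1 := addHaar_image_eq_zero_of_det_fderivWithin_eq_zero (volume : Measure ℂ) (s := univ)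
    (f := fun z : ℂ => g z.re)
    (f' := fun z => (ContinuousLinearMap.toSpanSingleton ℝ (g' z.re)).comp Complex.reCLM)
    (fun z _ => ((h.hasDerivAt z.re).hasFDerivAt.comp z
      Complex.reCLM.hasFDerivAt).hasFDerivWithinAt) (fun z _ => ?_)
  · rw [image_univ] at h1
    refine measure_mono_null ?_ h1
    rintro _ ⟨t, rfl⟩
    exact ⟨t, by simp⟩
  · by_contra hne
    have hinj := (LinearMap.equivOfDetNeZero _ hne).injective
    have : (I : ℂ) = 0 := by
      apply hinj
      simp [LinearMap.equivOfDetNeZero]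
    exact Complex.I_ne_zero this

lemma integral_windingAngle (h : IsSimpleClosedCurve g g' T) {R : ℝ} (hR : ∀ t, ‖g t‖ < R) :
    ∫ q in ball (0 : ℂ) R, windingAngle g g' T q =
      π * ∫ t in 0..T, (g' t * (starRingEnd ℂ) (g t)).im := by
  have hT := h.pos
  have hg := h.continuous
  have hg' := h.continuous_deriv
  obtain ⟨M, hM, hM'⟩ := h.exists_deriv_upper_bound
  set μ : Measure ℂ := volume.restrict (ball (0 : ℂ) R)
  have hmeas : AEStronglyMeasurable (Function.uncurry fun (t : ℝ) (q : ℂ) => g' t / (g t - q))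
      ((volume.restrict (uIoc 0 T)).prod μ) := by
    apply Measurable.aestronglyMeasurable
    have m1 := hg.measurable
    have m2 := hg'.measurable
    unfold Function.uncurry
    fun_prop
  have hbound : ∀ t, ∫ q, ‖g' t / (g t - q)‖ ∂μ ≤
      M * ∫ u in ball (0 : ℂ) (2 * R), ‖(0 - u)⁻¹‖ := by
    intro t
    have e1 : ∫ q, ‖g' t / (g t - q)‖ ∂μ = ‖g' t‖ * ∫ q, ‖(g t - q)⁻¹‖ ∂μ := by
      rw [← integral_const_mul]
      simp only [div_eq_mul_inv, norm_mul]
    have e2 : ∫ q, ‖(g t - q)⁻¹‖ ∂μ ≤ ∫ u in ball (0 : ℂ) (2 * R), ‖(0 - u)⁻¹‖ := by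
      rw [← integral_indicator measurableSet_ball, ← integral_indicator measurableSet_ball,
        ← integral_sub_right_eq_self (fun u => (ball (0 : ℂ) (2 * R)).indicator
          (fun u => ‖(0 - u)⁻¹‖) u) (g t)]
      have i1 := (integrable_indicator_iff measurableSet_ball).2 (integrableOn_inv_sub_ball (g t) R).norm
      have i2 := (integrable_indicator_iff measurableSet_ball).2
        (integrableOn_inv_sub_ball 0 (2 * R)).norm
      refine integral_mono i1 (i2.comp_sub_right (g t)) fun q => ?_
      by_cases hq : ‖q‖ < R
      · have : ‖q - g t‖ < 2 * R := by
          linarith [norm_sub_le q (g t), hR t]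
        simp [indicator, hq, this]
      · simp only [indicator, mem_ball, dist_zero_right, hq, if_false]
        split_ifs <;> positivity
    rw [e1]
    exact mul_le_mul (hM' t) e2 (integral_nonneg fun _ => norm_nonneg _) hM.le
  have hint : Integrable (Function.uncurry fun (t : ℝ) (q : ℂ) => g' t / (g t - q))
      ((volume.restrict (uIoc 0 T)).prod μ) := by
    rw [integrable_prod_iff hmeas]
    refine ⟨.of_forall fun t => ?_, ?_⟩
    · simp only [Function.uncurry_apply_pair, div_eq_mul_inv]
      exact (integrableOn_inv_sub_ball (g t) R).const_mul (g' t)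
    · refine Integrable.mono' (g := fun _ => M * ∫ u in ball (0 : ℂ) (2 * R), ‖(0 - u)⁻¹‖)
        (by rw [uIoc_of_le hT.le]; exact integrable_const _) hmeas.norm.integral_prod_right' (.of_forall fun t => ?_)
      rw [Real.norm_of_nonneg (integral_nonneg fun _ => norm_nonneg _)]
      exact hbound t
  have hswap := intervalIntegral_integral_swap hint
  have hint2 : Integrable (fun q => ∫ t in 0..T, g' t / (g t - q)) μ := by
    have := hint.integral_prod_right
    simpa only [Function.uncurry_apply_pair, uIoc_of_le hT.le,
      ← intervalIntegral.integral_of_le hT.le] using this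
  have e3 : ∀ t, ∫ q, g' t / (g t - q) ∂μ = π * (g' t * (starRingEnd ℂ) (g t)) := by
    intro t
    simp only [div_eq_mul_inv]
    rw [integral_const_mul, integral_ball_inv_sub (hR t)]
    ring
  simp only [e3] at hswap
  rw [intervalIntegral.integral_const_mul] at hswap
  have e4 := Complex.imCLM.integral_comp_comm hint2
  have hcc : Continuous fun t => g' t * (starRingEnd ℂ) (g t) :=
    hg'.mul (Complex.continuous_conj.comp hg)
  have e5 := Complex.imCLM.intervalIntegral_comp_comm
    (hcc.intervalIntegrable (μ := volume) 0 T)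
  simp only [Complex.imCLM_apply] at e4 e5
  unfold windingAngle
  rw [e4, e5, ← hswap, Complex.im_ofReal_mul]

lemma integral_im_nonneg (h : IsSimpleClosedCurve g g' T) {s₀ : ℝ}
    (hmin : ∀ t, (g s₀).im ≤ (g t).im) (hre : 0 < (g' s₀).re) (him : (g' s₀).im = 0) :
    0 ≤ ∫ t in 0..T, (g' t * (starRingEnd ℂ) (g t)).im := by
  obtain ⟨R, -, hR⟩ := h.exists_norm_bound
  have h1 := h.integral_windingAngle hR
  have h2 : 0 ≤ ∫ q in ball (0 : ℂ) R, windingAngle g g' T q := by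
    apply integral_nonneg_of_ae
    have : ∀ᵐ q : ℂ, q ∉ range g := measure_eq_zero_iff_ae_notMem.1 h.volume_range_eq_zero
    filter_upwards [ae_restrict_of_ae this] with q hq
    exact h.windingAngle_nonneg hmin hre him hq
  rw [h1] at h2
  exact nonneg_of_mul_nonneg_right h2 Real.pi_pos

end IsSimpleClosedCurve

/-- The secant slope of a primitive of `g'` between `s` and `t`, extended continuously to the
diagonal. -/
noncomputable def secant (g' : ℝ → ℂ) (s t : ℝ) : ℂ := ∫ x in (0 : ℝ)..1, g' (s + x * (t - s))

/-- The chord of a `T`-periodic curve from `s` to `s + h`, rescaled so as to extend continuously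
to `h = 0` and `h = T` by the tangent vectors. -/
noncomputable def chord (g' : ℝ → ℂ) (T s h : ℝ) : ℂ :=
  secant g' s (s + h) - secant g' (s + h) (s + T)

lemma secant_self (g' : ℝ → ℂ) (s : ℝ) : secant g' s s = g' s := by simp [secant]

lemma exists_continuous_log_s18 {X : Type*} [TopologicalSpace X] [SimplyConnectedSpace X]
    [LocallyPathConnectedSpace X] {f : X → ℂ} (hf : Continuous f) (h0 : ∀ x, f x ≠ 0) :
    ∃ F : X → ℂ, Continuous F ∧ ∀ x, Complex.exp (F x) = f x := by
  obtain ⟨x₀⟩ : Nonempty X := inferInstance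
  obtain ⟨F, ⟨-, hF⟩, -⟩ := Complex.isCoveringMapOn_exp.existsUnique_continuousMap_lifts ⟨f, hf⟩
    (a₀ := x₀) (Complex.exp_log (h0 x₀)) h0
  exact ⟨F, F.continuous, fun x => congr_fun hF x⟩

/-- A continuous angle that stays in the upper half plane and goes from the negative to the positive
real axis changes by `-π`. -/
lemma angle_sub_eq_neg_pi {φ : ℝ → ℝ} {T : ℝ} (hT : 0 ≤ T) (hφ : ContinuousOn φ (Icc 0 T))
    (hsin : ∀ h ∈ Icc 0 T, 0 ≤ sin (φ h)) (h0 : sin (φ 0) = 0) (h0' : cos (φ 0) < 0)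
    (hT0 : sin (φ T) = 0) (hT0' : 0 < cos (φ T)) : φ T - φ 0 = -π := by
  obtain ⟨m, hm⟩ : ∃ m : ℤ, φ T = m * (2 * π) := by
    have : cos (φ T) = 1 := by nlinarith [sin_sq_add_cos_sq (φ T)]
    obtain ⟨m, hm⟩ := (Real.cos_eq_one_iff _).1 this
    exact ⟨m, hm.symm⟩
  obtain ⟨k, hk⟩ : ∃ k : ℤ, φ 0 = k * (2 * π) + π := by
    have : cos (φ 0) = -1 := by nlinarith [sin_sq_add_cos_sq (φ 0)]
    obtain ⟨k, hk⟩ := Real.cos_eq_neg_one_iff.1 this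
    exact ⟨k, by rw [← hk]; ring⟩
  have hpi := Real.pi_pos
  have up : φ T < φ 0 + π / 2 := by
    by_contra! hle
    obtain ⟨x, hx, hx'⟩ := intermediate_value_Icc hT hφ ⟨by linarith, hle⟩
    have := hsin x hx
    rw [hx', hk, show k * (2 * π) + π + π / 2 = π / 2 + π + k * (2 * π) by ring,
      Real.sin_add_int_mul_two_pi, Real.sin_add_pi, Real.sin_pi_div_two] at this
    linarith
  have down : φ 0 - 3 * π / 2 < φ T := by
    by_contra! hle
    obtain ⟨x, hx, hx'⟩ := intermediate_value_Icc' hT hφ ⟨hle, by linarith⟩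
    have := hsin x hx
    rw [hx', hk, show k * (2 * π) + π - 3 * π / 2 = -(π / 2) + k * (2 * π) by ring,
      Real.sin_add_int_mul_two_pi, Real.sin_neg, Real.sin_pi_div_two] at this
    linarith
  have hmk : m = k := by
    rw [hm, hk] at up down
    have h1 : ((m : ℝ) - k) < 1 := by
      refine lt_of_mul_lt_mul_right (a := 2 * π) ?_ (by positivity)
      linarith
    have h2 : (-1 : ℝ) < ((m : ℝ) - k) := by
      refine lt_of_mul_lt_mul_right (a := 2 * π) ?_ (by positivity)
      linarith
    have h1' : m - k < 1 := by exact_mod_cast h1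
    have h2' : -1 < m - k := by exact_mod_cast h2
    omega
  rw [hm, hk, hmk]
  ring

namespace IsSimpleClosedCurve

variable {g g' : ℝ → ℂ} {T : ℝ}

lemma sub_smul_secant (h : IsSimpleClosedCurve g g' T) (s t : ℝ) :
    (t - s) • secant g' s t = g t - g s := by
  have h1 : ∀ x ∈ uIcc (0 : ℝ) 1, HasDerivAt (fun x : ℝ => g (s + x * (t - s)))
      ((t - s) • g' (s + x * (t - s))) x := by
    intro x _
    have h2 : HasDerivAt (fun x : ℝ => s + x * (t - s)) (t - s) x := by
      simpa using ((hasDerivAt_id x).mul_const (t - s)).const_add s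
    exact (h.hasDerivAt _).scomp x h2
  have hc := h.continuous_deriv
  have h3 := intervalIntegral.integral_eq_sub_of_hasDerivAt h1
    ((by fun_prop : Continuous fun x : ℝ => (t - s) • g' (s + x * (t - s))).intervalIntegrable _ _)
  rw [intervalIntegral.integral_smul] at h3
  rw [secant, h3]
  simp

lemma secant_add_period (h : IsSimpleClosedCurve g g' T) (s t : ℝ) :
    secant g' (s + T) (t + T) = secant g' s t := by
  unfold secant
  congr 1
  ext x
  rw [← h.periodic_deriv (s + x * (t - s))]
  congr 1
  ring

lemma continuous_chord (h : IsSimpleClosedCurve g g' T) :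
    Continuous fun p : ℝ × ℝ => chord g' T p.1 p.2 := by
  have hs : Continuous fun p : ℝ × ℝ => secant g' p.1 p.2 := by
    have hc := h.continuous_deriv
    exact intervalIntegral.continuous_parametric_intervalIntegral_of_continuous'
      (f := fun (p : ℝ × ℝ) x => g' (p.1 + x * (p.2 - p.1)))
      (by unfold Function.uncurry; fun_prop) 0 1
  exact (hs.comp (by fun_prop : Continuous fun p : ℝ × ℝ => (p.1, p.1 + p.2))).sub
    (hs.comp (by fun_prop : Continuous fun p : ℝ × ℝ => (p.1 + p.2, p.1 + T)))

lemma secant_period (h : IsSimpleClosedCurve g g' T) (s : ℝ) : secant g' s (s + T) = 0 := by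
  have := h.sub_smul_secant s (s + T)
  rw [h.periodic, sub_self, add_sub_cancel_left] at this
  exact (smul_eq_zero.1 this).resolve_left h.pos.ne'

lemma chord_zero (h : IsSimpleClosedCurve g g' T) (s : ℝ) : chord g' T s 0 = g' s := by
  simp [chord, secant_self, h.secant_period]

lemma chord_period (h : IsSimpleClosedCurve g g' T) (s : ℝ) : chord g' T s T = -g' s := by
  simp [chord, secant_self, h.secant_period, h.periodic_deriv s]

lemma chord_add_period (h : IsSimpleClosedCurve g g' T) (s x : ℝ) :
    chord g' T (s + T) x = chord g' T s x := by
  rw [chord, chord, add_right_comm s T x, h.secant_add_period, h.secant_add_period]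

lemma chord_reflect (h : IsSimpleClosedCurve g g' T) (s x : ℝ) :
    chord g' T (s + x) (T - x) = -chord g' T s x := by
  rw [chord, chord, show s + x + (T - x) = s + T by ring, h.secant_add_period, neg_sub]

lemma chord_eq (h : IsSimpleClosedCurve g g' T) (s : ℝ) {x : ℝ} (hx : x ∈ Ioo 0 T) :
    chord g' T s x = (1 / x + 1 / (T - x)) • (g (s + x) - g s) := by
  have hx0 : x ≠ 0 := hx.1.ne'
  have hx1 : T - x ≠ 0 := (sub_pos.2 hx.2).ne'
  have h1 : secant g' s (s + x) = (1 / x) • (g (s + x) - g s) := by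
    rw [← h.sub_smul_secant, smul_smul, add_sub_cancel_left, one_div_mul_cancel hx0, one_smul]
  have h2 : secant g' (s + x) (s + T) = (1 / (T - x)) • (g s - g (s + x)) := by
    rw [← h.periodic s, ← h.sub_smul_secant, smul_smul, add_sub_add_left_eq_sub,
      one_div_mul_cancel hx1, one_smul]
  rw [chord, h1, h2, add_smul, ← neg_sub (g (s + x)) (g s), smul_neg, sub_neg_eq_add]

lemma chord_ne_zero (h : IsSimpleClosedCurve g g' T) (s : ℝ) {x : ℝ} (hx : x ∈ Icc 0 T) :
    chord g' T s x ≠ 0 := by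
  rcases eq_or_lt_of_le hx.1 with rfl | h0
  · rw [h.chord_zero]
    exact h.deriv_ne s
  rcases eq_or_lt_of_le hx.2 with rfl | h1
  · rw [h.chord_period]
    exact neg_ne_zero.2 (h.deriv_ne s)
  rw [h.chord_eq s ⟨h0, h1⟩]
  have := sub_pos.2 h1
  exact smul_ne_zero (by positivity)
    (sub_ne_zero.2 (h.ne s (s + x) (by linarith) (by linarith)).symm)

/-- Hopf's argument: if the tangent vector points to the left at a lowest point of the curve, then
the tangent makes exactly `-1` turn. -/
lemma turning_eq_neg_one (h : IsSimpleClosedCurve g g' T) {s₀ : ℝ}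
    (hmin : ∀ t, (g s₀).im ≤ (g t).im) (hre : (g' s₀).re < 0) (him : (g' s₀).im = 0)
    {a : ℝ} {w : ℝ → ℝ} (hwc : ContinuousOn w (Icc a (a + T)))
    (hw : ∀ t ∈ Icc a (a + T), g' t = ‖g' t‖ * Complex.exp ((2 * π * w t : ℝ) * I)) :
    w (a + T) - w a = -1 := by
  have hT := h.pos
  obtain ⟨Λ, hΛc, hΛ⟩ := exists_continuous_log_s18
    (f := fun p : ℝ × ℝ => chord g' T p.1 (max 0 (min p.2 T)))
    (h.continuous_chord.comp
      (by fun_prop : Continuous fun p : ℝ × ℝ => (p.1, max 0 (min p.2 T))))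
    (fun p => h.chord_ne_zero _ ⟨le_max_left _ _, max_le hT.le (min_le_right _ _)⟩)
  have hΛ' : ∀ s, ∀ x ∈ Icc 0 T, Complex.exp (Λ (s, x)) = chord g' T s x := by
    intro s x hx
    rw [hΛ, min_eq_left hx.2, max_eq_right hx.1]
  have hre' : ∀ s, ∀ x ∈ Icc 0 T,
      rexp (Λ (s, x)).re * cos (Λ (s, x)).im = (chord g' T s x).re := by
    intro s x hx
    rw [← hΛ' s x hx, Complex.exp_re]
  have him' : ∀ s, ∀ x ∈ Icc 0 T,
      rexp (Λ (s, x)).re * sin (Λ (s, x)).im = (chord g' T s x).im := by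
    intro s x hx
    rw [← hΛ' s x hx, Complex.exp_im]
  have m0 : (0 : ℝ) ∈ Icc 0 T := left_mem_Icc.2 hT.le
  have mT : T ∈ Icc 0 T := right_mem_Icc.2 hT.le
  have ho : ∀ z w : ℂ, Complex.exp z = Complex.exp w → ∃ n : ℤ, z.im - w.im = n * (2 * π) := by
    intro z w hzw
    obtain ⟨n, hn⟩ := Complex.exp_eq_exp_iff_exists_int.1 hzw
    exact ⟨n, by rw [hn]; simp⟩
  have hpi : (2 * π) ≠ 0 := by positivity
  -- first half of the deformed path
  have half : (Λ (s₀, T)).im - (Λ (s₀, 0)).im = -π := by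
    refine angle_sub_eq_neg_pi (φ := fun x => (Λ (s₀, x)).im) hT.le (by fun_prop) ?_ ?_ ?_ ?_ ?_
    · intro x hx
      have h1 := him' s₀ x hx
      refine nonneg_of_mul_nonneg_right (h1 ▸ ?_) (exp_pos (Λ (s₀, x)).re)
      rcases eq_or_lt_of_le hx.1 with rfl | h0
      · rw [h.chord_zero, him]
      rcases eq_or_lt_of_le hx.2 with rfl | h1
      · rw [h.chord_period, Complex.neg_im, him, neg_zero]
      rw [h.chord_eq s₀ ⟨h0, h1⟩, Complex.smul_im, Complex.sub_im]
      have := sub_pos.2 h1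
      exact mul_nonneg (by positivity) (sub_nonneg.2 (hmin _))
    · have h1 := him' s₀ 0 m0
      rw [h.chord_zero, him] at h1
      exact (mul_eq_zero.1 h1).resolve_left (exp_pos _).ne'
    · have h1 := hre' s₀ 0 m0
      rw [h.chord_zero] at h1
      exact neg_of_mul_neg_right (h1 ▸ hre) (exp_pos _).le
    · have h1 := him' s₀ T mT
      rw [h.chord_period, Complex.neg_im, him, neg_zero] at h1
      exact (mul_eq_zero.1 h1).resolve_left (exp_pos _).ne'
    · have h1 := hre' s₀ T mT
      rw [h.chord_period, Complex.neg_re] at h1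
      exact pos_of_mul_pos_right (h1 ▸ neg_pos.2 hre) (exp_pos _).le
  -- second half
  have sym := eqOn_of_forall_int_mul (isPreconnected_Icc (a := 0) (b := T))
    (f := fun x => (Λ (s₀ + x, T - x)).im - ((Λ (s₀, x)).im + π)) (by fun_prop) hpi
    (fun x hx => by
      have h1 : Complex.exp (Λ (s₀ + x, T - x)) = Complex.exp (Λ (s₀, x) + π * I) := by
        rw [Complex.exp_add, Complex.exp_pi_mul_I, hΛ' _ _ ⟨by linarith [hx.2], by linarith [hx.1]⟩,
          hΛ' _ _ hx, h.chord_reflect]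
        ring
      simpa using ho _ _ h1) m0 mT
  simp only [add_zero, sub_zero, sub_self] at sym
  have full : (Λ (s₀ + T, 0)).im - (Λ (s₀, 0)).im = -(2 * π) := by linarith
  have shift := eqOn_of_forall_int_mul (isPreconnected_univ (α := ℝ))
    (f := fun s => (Λ (s + T, 0)).im - (Λ (s, 0)).im) (by fun_prop) hpi
    (fun s _ => ho _ _ (by rw [hΛ' _ _ m0, hΛ' _ _ m0, h.chord_add_period])) (mem_univ a)
    (mem_univ s₀)
  have hlift := eqOn_of_forall_int_mul (isPreconnected_Icc (a := a) (b := a + T))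
    (f := fun t => (Λ (t, 0)).im - 2 * π * w t)
    (ContinuousOn.sub (by fun_prop) (continuousOn_const.mul hwc)) hpi
    (fun t ht => by
      have hpos : (‖g' t‖ : ℂ) ≠ 0 := by exact_mod_cast norm_ne_zero_iff.2 (h.deriv_ne t)
      have h1 : Complex.exp (Λ (t, 0)) =
          Complex.exp ((Real.log ‖g' t‖ : ℝ) + (2 * π * w t : ℝ) * I) := by
        rw [hΛ' _ _ m0, h.chord_zero, Complex.exp_add, Complex.ofReal_log (norm_nonneg _),
          Complex.exp_log hpos]
        exact hw t ht
      have h2 := ho _ _ h1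
      rwa [Complex.add_im, Complex.ofReal_im, zero_add, Complex.im_ofReal_mul, Complex.I_im,
        mul_one] at h2)
    (left_mem_Icc.2 (by linarith)) (right_mem_Icc.2 (by linarith))
  beta_reduce at shift hlift
  have : 2 * π * (w (a + T) - w a) = 2 * π * (-1) := by linarith
  exact mul_left_cancel₀ hpi this

/-- The theorem of turning tangents for a negatively oriented simple closed curve in `ℂ`. -/
theorem turning_of_integral_neg (h : IsSimpleClosedCurve g g' T)
    (hneg : ∫ t in 0..T, (g' t * (starRingEnd ℂ) (g t)).im < 0)
    {a : ℝ} {w : ℝ → ℝ} (hwc : ContinuousOn w (Icc a (a + T)))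
    (hw : ∀ t ∈ Icc a (a + T), g' t = ‖g' t‖ * Complex.exp ((2 * π * w t : ℝ) * I)) :
    w (a + T) - w a = -1 := by
  have hg := h.continuous
  obtain ⟨s₀, -, hs⟩ := (isCompact_Icc (a := 0) (b := T)).exists_isMinOn
    (nonempty_Icc.2 h.pos.le) (f := fun t => (g t).im) (by fun_prop)
  have hmin : ∀ t, (g s₀).im ≤ (g t).im := by
    intro t
    obtain ⟨t', ht', -, -, e, -⟩ := h.exists_shift t t
    rw [← e]
    exact hs (Ico_subset_Icc_self ht')
  have him : (g' s₀).im = 0 := by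
    have hl : IsLocalMin (fun t => (g t).im) s₀ := .of_forall hmin
    exact hl.hasDerivAt_eq_zero (Complex.imCLM.hasFDerivAt.comp_hasDerivAt s₀ (h.hasDerivAt s₀))
  rcases lt_trichotomy (g' s₀).re 0 with hre | hre | hre
  · exact h.turning_eq_neg_one hmin hre him hwc hw
  · exact absurd (Complex.ext hre him) (h.deriv_ne s₀)
  · exact absurd hneg (not_lt.2 (h.integral_im_nonneg hmin hre him))

end IsSimpleClosedCurve

/-- A simple closed `C¹` curve on an interval extends to a periodic one. -/
lemma exists_isSimpleClosedCurve_eqOn {a T : ℝ} (hT : 0 < T) {f f' : ℝ → ℂ}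
    (hf : ∀ t ∈ Icc a (a + T), HasDerivAt f (f' t) t) (hf' : ContinuousOn f' (Icc a (a + T)))
    (hclosed : f a = f (a + T)) (hclosed' : f' a = f' (a + T)) (hinj : InjOn f (Ico a (a + T)))
    (hne : ∀ t ∈ Icc a (a + T), f' t ≠ 0) :
    ∃ g g' : ℝ → ℂ, IsSimpleClosedCurve g g' T ∧ EqOn g f (Icc a (a + T)) ∧
      EqOn g' f' (Icc a (a + T)) := by
  have : Fact (0 < T) := ⟨hT⟩
  set g' : ℝ → ℂ := fun t => AddCircle.liftIco T a f' (t : AddCircle T) with hg'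
  have hg'c : Continuous g' :=
    (AddCircle.liftIco_continuous hclosed' hf').comp (AddCircle.continuous_mk' T)
  have hg'p : Function.Periodic g' T := fun t => by simp [hg']
  have hg'e : EqOn g' f' (Icc a (a + T)) := by
    intro t ht
    rcases ht.2.eq_or_lt with rfl | h
    · rw [hg'p, ← hclosed']
      exact AddCircle.liftIco_coe_apply ⟨le_rfl, by linarith⟩
    · exact AddCircle.liftIco_coe_apply ⟨ht.1, h⟩
  have hint : ∀ s t, IntervalIntegrable g' volume s t := fun s t => hg'c.intervalIntegrable s t
  set g : ℝ → ℂ := fun t => f a + ∫ x in a..t, g' x with hg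
  have hge : EqOn g f (Icc a (a + T)) := by
    intro t ht
    have hsub : uIcc a t ⊆ Icc a (a + T) := by
      rw [uIcc_of_le ht.1]
      exact Icc_subset_Icc_right ht.2
    have := intervalIntegral.integral_eq_sub_of_hasDerivAt (a := a) (b := t) (f := f) (f' := g')
      (fun x hx => by rw [hg'e (hsub hx)]; exact hf x (hsub hx)) (hint _ _)
    simp [hg, this]
  have hgp : Function.Periodic g T := by
    intro t
    have h0 : ∫ x in a..a + T, g' x = 0 := by
      have := hge (right_mem_Icc.2 (by linarith : a ≤ a + T))
      rw [← hclosed] at this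
      simpa [hg] using this
    have h1 := hg'p.intervalIntegral_add_eq t a
    rw [h0] at h1
    have h2 := intervalIntegral.integral_add_adjacent_intervals (hint a t) (hint t (t + T))
    simp only [hg]
    rw [← h2, h1, add_zero]
  refine ⟨g, g', ⟨hT, fun t => ?_, hg'c, hgp, hg'p, fun s t hst hts => ?_, fun t => ?_⟩, hge, hg'e⟩
  · exact (intervalIntegral.integral_hasDerivAt_right (hint a t)
      (hg'c.stronglyMeasurableAtFilter _ _) hg'c.continuousAt).const_add (f a)
  · have hs := sub_toIcoDiv_zsmul_mem_Ico hT a s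
    rw [← hgp.sub_zsmul_eq (toIcoDiv hT a s) (x := s),
      ← hgp.sub_zsmul_eq (toIcoDiv hT a s) (x := t)]
    set c := toIcoDiv hT a s • T
    rcases lt_or_ge (t - c) (a + T) with h | h
    · have ht : t - c ∈ Ico a (a + T) := ⟨by linarith [hs.1], h⟩
      rw [hge (Ico_subset_Icc_self hs), hge (Ico_subset_Icc_self ht)]
      intro h'
      linarith [hinj hs ht h']
    · have ht : t - c - T ∈ Ico a (a + T) := ⟨by linarith, by linarith [hs.2]⟩
      rw [← hgp.sub_eq (t - c), hge (Ico_subset_Icc_self hs), hge (Ico_subset_Icc_self ht)]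
      intro h'
      linarith [hinj hs ht h']
  · rw [← hg'p.sub_zsmul_eq (toIcoDiv hT a t) (x := t)]
    have ht := Ico_subset_Icc_self (sub_toIcoDiv_zsmul_mem_Ico hT a t)
    rw [hg'e ht]
    exact hne _ ht

/-- The theorem of turning tangents for a negatively oriented `C¹` simple closed curve
`f : [a, a + T] → ℂ`. -/
theorem complex_turning_of_integral_neg {a T : ℝ} (hT : 0 < T) {f f' : ℝ → ℂ}
    (hf : ∀ t ∈ Icc a (a + T), HasDerivAt f (f' t) t) (hf' : ContinuousOn f' (Icc a (a + T)))
    (hclosed : f a = f (a + T)) (hclosed' : f' a = f' (a + T)) (hinj : InjOn f (Ico a (a + T)))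
    (hne : ∀ t ∈ Icc a (a + T), f' t ≠ 0)
    (hneg : ∫ t in a..a + T, (f' t * (starRingEnd ℂ) (f t)).im < 0)
    {w : ℝ → ℝ} (hwc : ContinuousOn w (Icc a (a + T)))
    (hw : ∀ t ∈ Icc a (a + T), f' t = ‖f' t‖ * Complex.exp ((2 * π * w t : ℝ) * I)) :
    w (a + T) - w a = -1 := by
  obtain ⟨g, g', h, hg, hg'⟩ :=
    exists_isSimpleClosedCurve_eqOn hT hf hf' hclosed hclosed' hinj hne
  refine h.turning_of_integral_neg ?_ hwc fun t ht => by rw [hg' ht]; exact hw t ht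
  have hp : Function.Periodic (fun t => (g' t * (starRingEnd ℂ) (g t)).im) T := fun t => by
    simp only [h.periodic t, h.periodic_deriv t]
  have h1 := hp.intervalIntegral_add_eq 0 a
  rw [zero_add] at h1
  rw [h1]
  convert hneg using 1
  refine intervalIntegral.integral_congr fun t ht => ?_
  rw [uIcc_of_le (by linarith)] at ht
  simp only [hg ht, hg' ht]

end

/-- Hopf's Umlaufsatz (theorem of turning tangents) for a negatively oriented `C¹` simple
closed plane curve: the tangent direction makes exactly `-1` full turn. Negative orientation
is expressed by negativity of twice the signed enclosed area `∮ (x dy - y dx) < 0`. -/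
theorem umlaufsatz_negatively_oriented
    (a b : ℝ) (hab : a < b)
    (γ γ' : ℝ → EuclideanSpace ℝ (Fin 2))
    (hderiv : ∀ t ∈ Set.Icc a b, HasDerivAt γ (γ' t) t)
    (hγ'cont : ContinuousOn γ' (Set.Icc a b))
    (hclosed : γ a = γ b) (hclosed' : γ' a = γ' b)
    (hsimple : Set.InjOn γ (Set.Ico a b))
    (hreg : ∀ t ∈ Set.Icc a b, γ' t ≠ 0)
    (hneg : (∫ t in a..b, ((γ t) 0 * (γ' t) 1 - (γ t) 1 * (γ' t) 0)) < 0)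
    (w : ℝ → ℝ) (hwc : ContinuousOn w (Set.Icc a b))
    (hw : ∀ t ∈ Set.Icc a b, γ' t = ‖γ' t‖ • e2 (w t)) :
    w b - w a = -1 := by
  obtain ⟨T, hT, rfl⟩ : ∃ T, 0 < T ∧ b = a + T := ⟨b - a, by linarith, by ring⟩
  set L := Complex.orthonormalBasisOneI.repr.symm
  have hL : ∀ x : EuclideanSpace ℝ (Fin 2), L x = x 0 + x 1 * Complex.I := fun x =>
    Complex.orthonormalBasisOneI_repr_symm_apply x
  refine complex_turning_of_integral_neg hT (f := fun t => L (γ t)) (f' := fun t => L (γ' t))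
    (fun t ht => ?_) (L.continuous.comp_continuousOn hγ'cont) (congrArg L hclosed)
    (congrArg L hclosed') (L.injective.comp_injOn hsimple) (fun t ht => ?_) ?_ hwc fun t ht => ?_
  · exact L.toContinuousLinearEquiv.hasFDerivAt.comp_hasDerivAt t (hderiv t ht)
  · simpa using hreg t ht
  · convert hneg using 3 with t
    simp only [hL]
    simp
    ring
  · have h1 := congrArg L (hw t ht)
    rw [map_smul, Complex.real_smul] at h1
    rw [L.norm_map, h1, hL, Complex.exp_mul_I, ← Complex.ofReal_cos, ← Complex.ofReal_sin]
    rfl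
end
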